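/- arXiv:1804.07975 — 12 statements merged into one kernel-verified Lean document; each statement's English description precedes it below -/
import Mathlib

section
/- Let k ≥ 3 be an integer, G a simple graph with vertex set V, lists L : V → Finset (Fin k), u1, u2 ∈ V, and colors c1, c2, c' ∈ Fin k with c1 ≠ c2 and c' ∉ {c1, c2}. Suppose G contains a (c1,c2)-weak edge from u1 to u2 with internal vertices v1, v2, v3 (i.e., u1, v1, v2, v3, u2 induce a path in this order, v1, v2, v3 have no neighbors outside this path, and L(v1) = {c1, c2}, L(v2) = L(v3) = {c2, c'}). Then no proper list coloring c of G satisfies c(u1) = c1 and c(u2) = c2. -/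
/-- A proper list coloring of `G` with lists `L`. -/
def ProperListColoring {V : Type*} {k : ℕ} (G : SimpleGraph V) (L : V → Finset (Fin k))
    (c : V → Fin k) : Prop :=
  (∀ v, c v ∈ L v) ∧ ∀ ⦃x y : V⦄, G.Adj x y → c x ≠ c y

/-- a `(c1,c2)`-weak edge (with `c1 ≠ c2`) from `u1` to `u2` forbids the
color combination `(c1, c2)` on `(u1, u2)`. -/
theorem weak_edge_ne_forbids {k : ℕ} (hk : 3 ≤ k) {V : Type*} (G : SimpleGraph V)
    (L : V → Finset (Fin k)) (u1 u2 v1 v2 v3 : V) (c1 c2 c' : Fin k)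
    (hc12 : c1 ≠ c2) (hc'1 : c' ≠ c1) (hc'2 : c' ≠ c2)
    -- the five vertices are pairwise distinct and induce a path in this order
    (hnd : ([u1, v1, v2, v3, u2] : List V).Nodup)
    (h1 : G.Adj u1 v1) (h2 : G.Adj v1 v2) (h3 : G.Adj v2 v3) (h4 : G.Adj v3 u2)
    (hn1 : ¬ G.Adj u1 v2) (hn2 : ¬ G.Adj u1 v3) (hn3 : ¬ G.Adj u1 u2)
    (hn4 : ¬ G.Adj v1 v3) (hn5 : ¬ G.Adj v1 u2) (hn6 : ¬ G.Adj v2 u2)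
    -- the internal vertices `v1, v2, v3` have no neighbors outside the path
    (hout : ∀ w, w ∉ ({u1, v1, v2, v3, u2} : Set V) →
      ¬ G.Adj v1 w ∧ ¬ G.Adj v2 w ∧ ¬ G.Adj v3 w)
    -- the lists of the internal vertices
    (hL1 : L v1 = {c1, c2}) (hL2 : L v2 = {c2, c'}) (hL3 : L v3 = {c2, c'}) :
    ¬ ∃ c : V → Fin k, ProperListColoring G L c ∧ c u1 = c1 ∧ c u2 = c2 := by
  rintro ⟨c, ⟨hmem, hadj⟩, hu1, hu2⟩
  have hv1 : c v1 = c1 ∨ c v1 = c2 := by simpa [hL1] using hmem v1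
  have hv2 : c v2 = c2 ∨ c v2 = c' := by simpa [hL2] using hmem v2
  have hv3 : c v3 = c2 ∨ c v3 = c' := by simpa [hL3] using hmem v3
  have hv1_eq : c v1 = c2 := hv1.resolve_left fun h => hadj h1 (hu1.trans h.symm)
  have hv2_eq : c v2 = c' := hv2.resolve_left fun h => hadj h2 (hv1_eq.trans h.symm)
  have hv3_eq : c v3 = c2 := hv3.resolve_right fun h => hadj h3 (hv2_eq.trans h.symm)
  exact hadj h4 (hv3_eq.trans hu2.symm)
end

section
/- Let k ≥ 3 be an integer, G a simple graph with vertex set V, lists L : V → Finset (Fin k), u1, u2 ∈ V, and colors c1, c2, c' ∈ Fin k with c1 ≠ c2 and c' ∉ {c1, c2}. Suppose G contains a (c1,c2)-weak edge from u1 to u2 with internal vertices v1, v2, v3, and let G' be the induced subgraph of G on V \ {v1, v2, v3} (with the same lists). Then every proper list coloring of G' that does not assign c1 to u1 or does not assign c2 to u2 can be extended to a proper list coloring of G. -/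
/-- The internal vertices of a weak edge can be colored from their lists whenever the colors
`s`, `t` of its ends satisfy `s ≠ c1` or `t ≠ c2`. -/
theorem exists_weak_edge_colors {α : Type*} [DecidableEq α] {c1 c2 c' : α} (s t : α)
    (hc12 : c1 ≠ c2) (hc'1 : c' ≠ c1) (hc'2 : c' ≠ c2) (hst : s ≠ c1 ∨ t ≠ c2) :
    ∃ a b d : α, a ∈ ({c1, c2} : Finset α) ∧ b ∈ ({c2, c'} : Finset α) ∧
      d ∈ ({c2, c'} : Finset α) ∧ s ≠ a ∧ a ≠ b ∧ b ≠ d ∧ d ≠ t := by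
  by_cases hs : s = c1
  · exact ⟨c2, c', c2, by grind⟩
  · by_cases ht : t = c2
    · exact ⟨c1, c2, c', by grind⟩
    · exact ⟨c1, c', c2, by grind⟩

/-- any proper list coloring of `G` minus the internal vertices of a
`(c1,c2)`-weak edge (`c1 ≠ c2`) that does not assign `c1` to `u1` or does not assign `c2`
to `u2` extends to a proper list coloring of `G`.  A coloring of the induced subgraph
`G'` on `V \ {v1, v2, v3}` is modelled as a map `c₀ : V → Fin k` whose list and
properness conditions are only required outside `{v1, v2, v3}`; the extension agrees
with `c₀` outside `{v1, v2, v3}`. -/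
theorem weak_edge_ne_extends {k : ℕ} (hk : 3 ≤ k) {V : Type*} (G : SimpleGraph V)
    (L : V → Finset (Fin k)) (u1 u2 v1 v2 v3 : V) (c1 c2 c' : Fin k)
    (hc12 : c1 ≠ c2) (hc'1 : c' ≠ c1) (hc'2 : c' ≠ c2)
    -- the five vertices are pairwise distinct and induce a path in this order
    (hnd : ([u1, v1, v2, v3, u2] : List V).Nodup)
    (h1 : G.Adj u1 v1) (h2 : G.Adj v1 v2) (h3 : G.Adj v2 v3) (h4 : G.Adj v3 u2)
    (hn1 : ¬ G.Adj u1 v2) (hn2 : ¬ G.Adj u1 v3) (hn3 : ¬ G.Adj u1 u2)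
    (hn4 : ¬ G.Adj v1 v3) (hn5 : ¬ G.Adj v1 u2) (hn6 : ¬ G.Adj v2 u2)
    -- the internal vertices `v1, v2, v3` have no neighbors outside the path
    (hout : ∀ w, w ∉ ({u1, v1, v2, v3, u2} : Set V) →
      ¬ G.Adj v1 w ∧ ¬ G.Adj v2 w ∧ ¬ G.Adj v3 w)
    -- the lists of the internal vertices
    (hL1 : L v1 = {c1, c2}) (hL2 : L v2 = {c2, c'}) (hL3 : L v3 = {c2, c'})
    -- a proper list coloring of the induced subgraph on `V \ {v1, v2, v3}`
    (c₀ : V → Fin k)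
    (hc₀L : ∀ v, v ∉ ({v1, v2, v3} : Set V) → c₀ v ∈ L v)
    (hc₀adj : ∀ x y, x ∉ ({v1, v2, v3} : Set V) → y ∉ ({v1, v2, v3} : Set V) →
      G.Adj x y → c₀ x ≠ c₀ y)
    -- it does not assign `c1` to `u1`, or does not assign `c2` to `u2`
    (hfree : c₀ u1 ≠ c1 ∨ c₀ u2 ≠ c2) :
    ∃ c : V → Fin k, ProperListColoring G L c ∧
      ∀ v, v ∉ ({v1, v2, v3} : Set V) → c v = c₀ v := by
  classical
  obtain ⟨a, b, d, ha, hb, hd, hua, hab, hbd, hdu⟩ :=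
    exists_weak_edge_colors (c₀ u1) (c₀ u2) hc12 hc'1 hc'2 hfree
  simp only [List.nodup_cons, List.mem_cons, List.not_mem_nil, or_false, not_or,
    not_false_eq_true, List.nodup_nil, and_true] at hnd
  obtain ⟨⟨n11, n12, n13, n14⟩, ⟨m12, m13, m14⟩, ⟨p13, p14⟩, q14⟩ := hnd
  simp only [Set.mem_insert_iff, Set.mem_singleton_iff, not_or] at hout hc₀L hc₀adj ⊢
  set c : V → Fin k := fun v => if v = v1 then a else if v = v2 then b else
    if v = v3 then d else c₀ v with hc
  have e1 : c v1 = a := by simp [hc]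
  have e2 : c v2 = b := by simp [hc, Ne.symm m12]
  have e3 : c v3 = d := by simp [hc, Ne.symm m13, Ne.symm p13]
  have e0 : ∀ v, ¬ v = v1 ∧ ¬ v = v2 ∧ ¬ v = v3 → c v = c₀ v := fun v hv => by
    simp [hc, hv.1, hv.2.1, hv.2.2]
  have eu1 : c u1 = c₀ u1 := e0 u1 ⟨n11, n12, n13⟩
  have eu2 : c u2 = c₀ u2 := e0 u2 ⟨Ne.symm m14, Ne.symm p14, Ne.symm q14⟩
  clear_value c
  have nbr1 : ∀ y, G.Adj v1 y → c v1 ≠ c y := fun y hy => by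
    have := G.loopless.irrefl v1
    grind
  have nbr2 : ∀ y, G.Adj v2 y → c v2 ≠ c y := fun y hy => by
    have := G.loopless.irrefl v2
    grind [G.adj_comm]
  have nbr3 : ∀ y, G.Adj v3 y → c v3 ≠ c y := fun y hy => by
    have := G.loopless.irrefl v3
    grind [G.adj_comm]
  refine ⟨c, ⟨fun v => ?_, fun x y hxy => ?_⟩, e0⟩
  · by_cases hv : ¬ v = v1 ∧ ¬ v = v2 ∧ ¬ v = v3
    · rw [e0 v hv]
      exact hc₀L v hv
    · grind
  · by_cases hx : ¬ x = v1 ∧ ¬ x = v2 ∧ ¬ x = v3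
    · by_cases hy : ¬ y = v1 ∧ ¬ y = v2 ∧ ¬ y = v3
      · rw [e0 x hx, e0 y hy]
        exact hc₀adj x y hx hy hxy
      · have hyx := hxy.symm
        grind
    · grind
end

section
/- Let k ≥ 3 be an integer, G a simple graph with vertex set V, lists L : V → Finset (Fin k), u1, u2 ∈ V, a color c1 ∈ Fin k, and two distinct colors c', c'' ∈ Fin k both different from c1. Suppose G contains a (c1,c1)-weak edge from u1 to u2 with internal vertices v1, v2, v3 (i.e., u1, v1, v2, v3, u2 induce a path in this order, v1, v2, v3 have no neighbors outside this path, and L(v1) = {c1, c'}, L(v2) = {c', c''}, L(v3) = {c1, c''}). Then no proper list coloring c of G satisfies c(u1) = c1 and c(u2) = c1. -/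
/-- a `(c1,c1)`-weak edge from `u1` to `u2` forbids the color combination
`(c1, c1)` on `(u1, u2)`. -/
theorem weak_edge_eq_forbids {k : ℕ} (hk : 3 ≤ k) {V : Type*} (G : SimpleGraph V)
    (L : V → Finset (Fin k)) (u1 u2 v1 v2 v3 : V) (c1 c' c'' : Fin k)
    (hcc : c' ≠ c'') (hc'1 : c' ≠ c1) (hc''1 : c'' ≠ c1)
    -- the five vertices are pairwise distinct and induce a path in this order
    (hnd : ([u1, v1, v2, v3, u2] : List V).Nodup)
    (h1 : G.Adj u1 v1) (h2 : G.Adj v1 v2) (h3 : G.Adj v2 v3) (h4 : G.Adj v3 u2)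
    (hn1 : ¬ G.Adj u1 v2) (hn2 : ¬ G.Adj u1 v3) (hn3 : ¬ G.Adj u1 u2)
    (hn4 : ¬ G.Adj v1 v3) (hn5 : ¬ G.Adj v1 u2) (hn6 : ¬ G.Adj v2 u2)
    -- the internal vertices `v1, v2, v3` have no neighbors outside the path
    (hout : ∀ w, w ∉ ({u1, v1, v2, v3, u2} : Set V) →
      ¬ G.Adj v1 w ∧ ¬ G.Adj v2 w ∧ ¬ G.Adj v3 w)
    -- the lists of the internal vertices
    (hL1 : L v1 = {c1, c'}) (hL2 : L v2 = {c', c''}) (hL3 : L v3 = {c1, c''}) :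
    ¬ ∃ c : V → Fin k, ProperListColoring G L c ∧ c u1 = c1 ∧ c u2 = c1 := by
  rintro ⟨c, ⟨hmem, hadj⟩, hu1, hu2⟩
  have hv1 := hmem v1
  have hv2 := hmem v2
  have hv3 := hmem v3
  simp only [hL1, hL2, hL3, Finset.mem_insert, Finset.mem_singleton] at hv1 hv2 hv3
  have e1 := hadj h1
  have e2 := hadj h2
  have e3 := hadj h3
  have e4 := hadj h4
  grind
end

section
/- Let k ≥ 3 be an integer, G a simple graph with vertex set V, lists L : V → Finset (Fin k), u1, u2 ∈ V, a color c1 ∈ Fin k, and two distinct colors c', c'' ∈ Fin k both different from c1. Suppose G contains a (c1,c1)-weak edge from u1 to u2 with internal vertices v1, v2, v3, and let G' be the induced subgraph of G on V \ {v1, v2, v3} (with the same lists). Then every proper list coloring of G' that does not assign c1 to u1 or does not assign c1 to u2 can be extended to a proper list coloring of G. -/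
/-- A coloring that is proper outside three consecutive path vertices `v1, v2, v3`, whose only
neighbors lie on the path `u1, v1, v2, v3, u2`, extends to any choice of colors for these vertices
that is compatible with the lists and with the edges of the path. -/
theorem ProperListColoring.exists_extend_path {k : ℕ} {V : Type*} {G : SimpleGraph V}
    {L : V → Finset (Fin k)} {u1 u2 v1 v2 v3 : V} {c₀ : V → Fin k} {a b d : Fin k}
    (h12 : v1 ≠ v2) (h13 : v1 ≠ v3) (h23 : v2 ≠ v3)
    (hv1 : ∀ w, G.Adj v1 w → w = u1 ∨ w = v2)
    (hv2 : ∀ w, G.Adj v2 w → w = v1 ∨ w = v3)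
    (hv3 : ∀ w, G.Adj v3 w → w = v2 ∨ w = u2)
    (hu1 : u1 ∉ ({v1, v2, v3} : Set V)) (hu2 : u2 ∉ ({v1, v2, v3} : Set V))
    (hc₀L : ∀ v, v ∉ ({v1, v2, v3} : Set V) → c₀ v ∈ L v)
    (hc₀adj : ∀ x y, x ∉ ({v1, v2, v3} : Set V) → y ∉ ({v1, v2, v3} : Set V) →
      G.Adj x y → c₀ x ≠ c₀ y)
    (ha : a ∈ L v1) (hb : b ∈ L v2) (hd : d ∈ L v3)
    (hua : c₀ u1 ≠ a) (hab : a ≠ b) (hbd : b ≠ d) (hdu : d ≠ c₀ u2) :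
    ∃ c : V → Fin k, ProperListColoring G L c ∧
      ∀ v, v ∉ ({v1, v2, v3} : Set V) → c v = c₀ v := by
  classical
  let c : V → Fin k := fun v =>
    if v = v1 then a else if v = v2 then b else if v = v3 then d else c₀ v
  have hc1 : c v1 = a := by simp [c]
  have hc2 : c v2 = b := by simp [c, h12.symm]
  have hc3 : c v3 = d := by simp [c, h13.symm, h23.symm]
  have hc : ∀ v, v ∉ ({v1, v2, v3} : Set V) → c v = c₀ v := by
    intro v hv
    simp only [Set.mem_insert_iff, Set.mem_singleton_iff, not_or] at hv
    simp [c, hv]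
  have hcu1 := hc u1 hu1
  have hcu2 := hc u2 hu2
  have inner : ∀ x ∈ ({v1, v2, v3} : Set V), ∀ y, G.Adj x y → c x ≠ c y := by
    rintro x (rfl | rfl | rfl) y hxy
    · rcases hv1 y hxy with rfl | rfl
      · rw [hc1, hcu1]; exact hua.symm
      · rw [hc1, hc2]; exact hab
    · rcases hv2 y hxy with rfl | rfl
      · rw [hc1, hc2]; exact hab.symm
      · rw [hc2, hc3]; exact hbd
    · rcases hv3 y hxy with rfl | rfl
      · rw [hc2, hc3]; exact hbd.symm
      · rw [hc3, hcu2]; exact hdu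
  refine ⟨c, ⟨fun v => ?_, fun x y hxy => ?_⟩, hc⟩
  · by_cases hv : v ∈ ({v1, v2, v3} : Set V)
    · rcases hv with rfl | rfl | rfl
      · rwa [hc1]
      · rwa [hc2]
      · rwa [hc3]
    · rw [hc v hv]; exact hc₀L v hv
  · by_cases hx : x ∈ ({v1, v2, v3} : Set V)
    · exact inner x hx y hxy
    by_cases hy : y ∈ ({v1, v2, v3} : Set V)
    · exact (inner y hy x hxy.symm).symm
    rw [hc x hx, hc y hy]
    exact hc₀adj x y hx hy hxy

/-- any proper list coloring of `G` minus the internal vertices of a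
`(c1,c1)`-weak edge that does not assign `c1` to `u1` or does not assign `c1` to `u2`
extends to a proper list coloring of `G`.  A coloring of the induced subgraph `G'` on
`V \ {v1, v2, v3}` is modelled as a map `c₀ : V → Fin k` whose list and properness
conditions are only required outside `{v1, v2, v3}`; the extension agrees with `c₀`
outside `{v1, v2, v3}`. -/
theorem weak_edge_eq_extends {k : ℕ} (hk : 3 ≤ k) {V : Type*} (G : SimpleGraph V)
    (L : V → Finset (Fin k)) (u1 u2 v1 v2 v3 : V) (c1 c' c'' : Fin k)
    (hcc : c' ≠ c'') (hc'1 : c' ≠ c1) (hc''1 : c'' ≠ c1)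
    -- the five vertices are pairwise distinct and induce a path in this order
    (hnd : ([u1, v1, v2, v3, u2] : List V).Nodup)
    (h1 : G.Adj u1 v1) (h2 : G.Adj v1 v2) (h3 : G.Adj v2 v3) (h4 : G.Adj v3 u2)
    (hn1 : ¬ G.Adj u1 v2) (hn2 : ¬ G.Adj u1 v3) (hn3 : ¬ G.Adj u1 u2)
    (hn4 : ¬ G.Adj v1 v3) (hn5 : ¬ G.Adj v1 u2) (hn6 : ¬ G.Adj v2 u2)
    -- the internal vertices `v1, v2, v3` have no neighbors outside the path
    (hout : ∀ w, w ∉ ({u1, v1, v2, v3, u2} : Set V) →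
      ¬ G.Adj v1 w ∧ ¬ G.Adj v2 w ∧ ¬ G.Adj v3 w)
    -- the lists of the internal vertices
    (hL1 : L v1 = {c1, c'}) (hL2 : L v2 = {c', c''}) (hL3 : L v3 = {c1, c''})
    -- a proper list coloring of the induced subgraph on `V \ {v1, v2, v3}`
    (c₀ : V → Fin k)
    (hc₀L : ∀ v, v ∉ ({v1, v2, v3} : Set V) → c₀ v ∈ L v)
    (hc₀adj : ∀ x y, x ∉ ({v1, v2, v3} : Set V) → y ∉ ({v1, v2, v3} : Set V) →
      G.Adj x y → c₀ x ≠ c₀ y)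
    -- it does not assign `c1` to `u1`, or does not assign `c1` to `u2`
    (hfree : c₀ u1 ≠ c1 ∨ c₀ u2 ≠ c1) :
    ∃ c : V → Fin k, ProperListColoring G L c ∧
      ∀ v, v ∉ ({v1, v2, v3} : Set V) → c v = c₀ v := by
  simp only [List.nodup_cons, List.mem_cons, List.not_mem_nil, or_false, not_or,
    List.nodup_nil, not_false_eq_true, and_true] at hnd
  obtain ⟨⟨hu1v1, hu1v2, hu1v3, -⟩, ⟨h12, h13, hv1u2⟩, ⟨h23, hv2u2⟩, hv3u2⟩ := hnd
  have hu1 : u1 ∉ ({v1, v2, v3} : Set V) := by simp [hu1v1, hu1v2, hu1v3]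
  have hu2 : u2 ∉ ({v1, v2, v3} : Set V) := by simp [Ne.symm hv1u2, Ne.symm hv2u2, Ne.symm hv3u2]
  have hpath : ∀ w, G.Adj v1 w ∨ G.Adj v2 w ∨ G.Adj v3 w →
      w = u1 ∨ w = v1 ∨ w = v2 ∨ w = v3 ∨ w = u2 := by
    intro w hw
    by_contra hmem
    have := hout w hmem
    tauto
  have hv1 : ∀ w, G.Adj v1 w → w = u1 ∨ w = v2 := by
    intro w hw
    rcases hpath w (.inl hw) with rfl | rfl | rfl | rfl | rfl <;> simp_all
  have hv2 : ∀ w, G.Adj v2 w → w = v1 ∨ w = v3 := by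
    intro w hw
    rcases hpath w (.inr (.inl hw)) with rfl | rfl | rfl | rfl | rfl <;>
      simp_all [G.adj_comm]
  have hv3 : ∀ w, G.Adj v3 w → w = v2 ∨ w = u2 := by
    intro w hw
    rcases hpath w (.inr (.inr hw)) with rfl | rfl | rfl | rfl | rfl <;>
      simp_all [G.adj_comm]
  have extend {a b d : Fin k} :=
    ProperListColoring.exists_extend_path (a := a) (b := b) (d := d)
      h12 h13 h23 hv1 hv2 hv3 hu1 hu2 hc₀L hc₀adj
  rw [hL1, hL2, hL3] at extend
  rcases hfree with hf | hf
  · by_cases h : c₀ u2 = c''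
    · exact extend (a := c1) (b := c') (d := c1) (by simp) (by simp) (by simp)
        hf hc'1.symm hc'1 (h ▸ hc''1.symm)
    · exact extend (a := c1) (b := c') (d := c'') (by simp) (by simp) (by simp)
        hf hc'1.symm hcc (Ne.symm h)
  · by_cases h : c₀ u1 = c'
    · exact extend (a := c1) (b := c'') (d := c1) (by simp) (by simp) (by simp)
        (h ▸ hc'1) hc''1.symm hc''1 hf.symm
    · exact extend (a := c') (b := c'') (d := c1) (by simp) (by simp) (by simp)
        h hcc hc''1 hf.symm
end

section
/- Let k ≥ 3 be an integer, G a simple graph with vertex set V, lists L : V → Finset (Fin k), u1, u2 ∈ V, and colors c1, c2 ∈ Fin k. Suppose G contains a (c1→c2)-implication gadget from u1 to u2, i.e., for each color c' ≠ c2 a (c1,c')-weak edge from u1 to u2, where the triples of internal vertices of the different weak edges are pairwise disjoint and each internal vertex has no neighbors outside its own weak-edge path. Then no proper list coloring c of G satisfies c(u1) = c1 and c(u2) ≠ c2. -/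
/-- `u1, v1, v2, v3, u2` are pairwise distinct, induce a path in this order, and the
internal vertices `v1, v2, v3` have no neighbors outside this path. -/
def WeakEdgePath {V : Type*} (G : SimpleGraph V) (u1 u2 v1 v2 v3 : V) : Prop :=
  ([u1, v1, v2, v3, u2] : List V).Nodup ∧
  G.Adj u1 v1 ∧ G.Adj v1 v2 ∧ G.Adj v2 v3 ∧ G.Adj v3 u2 ∧
  ¬ G.Adj u1 v2 ∧ ¬ G.Adj u1 v3 ∧ ¬ G.Adj u1 u2 ∧
  ¬ G.Adj v1 v3 ∧ ¬ G.Adj v1 u2 ∧ ¬ G.Adj v2 u2 ∧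
  ∀ w, w ∉ ({u1, v1, v2, v3, u2} : Set V) →
    ¬ G.Adj v1 w ∧ ¬ G.Adj v2 w ∧ ¬ G.Adj v3 w

/-- A `(c1,c2)`-weak edge from `u1` to `u2` with internal vertices `v1, v2, v3`:
the path structure together with the lists, which depend on whether `c1 = c2`. -/
def WeakEdge {V : Type*} {k : ℕ} (G : SimpleGraph V) (L : V → Finset (Fin k))
    (u1 u2 : V) (c1 c2 : Fin k) (v1 v2 v3 : V) : Prop :=
  WeakEdgePath G u1 u2 v1 v2 v3 ∧
  (c1 ≠ c2 → ∃ c' : Fin k, c' ≠ c1 ∧ c' ≠ c2 ∧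
    L v1 = {c1, c2} ∧ L v2 = {c2, c'} ∧ L v3 = {c2, c'}) ∧
  (c1 = c2 → ∃ c' c'' : Fin k, c' ≠ c'' ∧ c' ≠ c1 ∧ c'' ≠ c1 ∧
    L v1 = {c1, c'} ∧ L v2 = {c', c''} ∧ L v3 = {c1, c''})

/-- A `(c1 → c2)`-implication gadget from `u1` to `u2`: for each color `c' ≠ c2` a
`(c1,c')`-weak edge from `u1` to `u2`, where `w c'` gives its triple of internal
vertices, and the triples of internal vertices are pairwise disjoint. -/
def Implication {V : Type*} {k : ℕ} (G : SimpleGraph V) (L : V → Finset (Fin k))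
    (u1 u2 : V) (c1 c2 : Fin k) (w : Fin k → V × V × V) : Prop :=
  (∀ c' : Fin k, c' ≠ c2 →
    WeakEdge G L u1 u2 c1 c' (w c').1 (w c').2.1 (w c').2.2) ∧
  (∀ c' c'' : Fin k, c' ≠ c2 → c'' ≠ c2 → c' ≠ c'' →
    Disjoint ({(w c').1, (w c').2.1, (w c').2.2} : Set V)
      ({(w c'').1, (w c'').2.1, (w c'').2.2} : Set V))

/-- A weak edge forbids its pair of colors on its two ends. -/
theorem WeakEdge.not_coloring_ends {V : Type*} {k : ℕ} {G : SimpleGraph V}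
    {L : V → Finset (Fin k)} {u1 u2 v1 v2 v3 : V} {c1 c2 : Fin k}
    (h : WeakEdge G L u1 u2 c1 c2 v1 v2 v3) {c : V → Fin k}
    (hc : ProperListColoring G L c) : ¬ (c u1 = c1 ∧ c u2 = c2) := by
  rintro ⟨hu1, hu2⟩
  obtain ⟨⟨-, h1, h2, h3, h4, -⟩, hne, heq⟩ := h
  have m1 := hc.1 v1
  have m2 := hc.1 v2
  have m3 := hc.1 v3
  have e1 := hc.2 h1
  have e2 := hc.2 h2
  have e3 := hc.2 h3
  have e4 := hc.2 h4
  by_cases hcc : c1 = c2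
  · obtain ⟨c', c'', -, -, -, hL1, hL2, hL3⟩ := heq hcc
    simp only [hL1, hL2, hL3, Finset.mem_insert, Finset.mem_singleton] at m1 m2 m3
    grind
  · obtain ⟨c', -, -, hL1, hL2, hL3⟩ := hne hcc
    simp only [hL1, hL2, hL3, Finset.mem_insert, Finset.mem_singleton] at m1 m2 m3
    grind

/-- if `G` contains a `(c1 → c2)`-implication gadget from `u1` to `u2`,
then no proper list coloring of `G` assigns `c1` to `u1` and a color other than `c2`
to `u2`. -/
theorem implication_forbids {k : ℕ} (hk : 3 ≤ k) {V : Type*} (G : SimpleGraph V)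
    (L : V → Finset (Fin k)) (u1 u2 : V) (c1 c2 : Fin k) (w : Fin k → V × V × V)
    (himp : Implication G L u1 u2 c1 c2 w) :
    ¬ ∃ c : V → Fin k, ProperListColoring G L c ∧ c u1 = c1 ∧ c u2 ≠ c2 := by
  rintro ⟨c, hc, h1, h2⟩
  exact (himp.1 (c u2) h2).not_coloring_ends hc ⟨h1, rfl⟩
end

section
/- Let k ≥ 3 be an integer, G a simple graph with vertex set V, lists L : V → Finset (Fin k), u1, u2 ∈ V, and colors c1, c2 ∈ Fin k. Suppose G contains a (c1→c2)-implication gadget from u1 to u2, and let G' be the induced subgraph of G obtained by deleting all internal vertices of the gadget (with the same lists). Then every proper list coloring of G' that either does not assign c1 to u1, or assigns c2 to u2, can be extended to a proper list coloring of G. -/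
/-- The set of internal vertices of a `(c1 → c2)`-implication gadget with internal
triples given by `w`. -/
def ImplicationInternals {V : Type*} {k : ℕ} (c2 : Fin k) (w : Fin k → V × V × V) : Set V :=
  {x | ∃ c' : Fin k, c' ≠ c2 ∧ (x = (w c').1 ∨ x = (w c').2.1 ∨ x = (w c').2.2)}

/-- If the ends of a `(c1, c2)`-weak edge have colors `p` and `q` with `p ≠ c1` or `q ≠ c2`, then
the internal vertices can be properly colored from their lists. -/
theorem WeakEdge.exists_internal_colors {V : Type*} {k : ℕ} {G : SimpleGraph V}
    {L : V → Finset (Fin k)} {u1 u2 v1 v2 v3 : V} {c1 c2 : Fin k}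
    (h : WeakEdge G L u1 u2 c1 c2 v1 v2 v3) {p q : Fin k} (hpq : p ≠ c1 ∨ q ≠ c2) :
    ∃ t : Fin k × Fin k × Fin k, t.1 ∈ L v1 ∧ t.2.1 ∈ L v2 ∧ t.2.2 ∈ L v3 ∧
      p ≠ t.1 ∧ t.1 ≠ t.2.1 ∧ t.2.1 ≠ t.2.2 ∧ t.2.2 ≠ q := by
  obtain ⟨-, hne, heq⟩ := h
  by_cases hc : c1 = c2
  · obtain ⟨d, e, hde, hd, he, h1, h2, h3⟩ := heq hc
    subst hc
    rw [h1, h2, h3]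
    by_cases hp : p = c1
    · exact ⟨(d, e, c1), by grind⟩
    · by_cases hq : q = c1
      · exact ⟨(c1, d, e), by grind⟩
      · exact ⟨(c1, d, c1), by grind⟩
  · obtain ⟨d, hd1, hd2, h1, h2, h3⟩ := hne hc
    rw [h1, h2, h3]
    by_cases hp : p = c1
    · exact ⟨(c2, d, c2), by grind⟩
    · by_cases hq : q = c2
      · exact ⟨(c1, c2, d), by grind⟩
      · exact ⟨(c1, d, c2), by grind⟩

/-- Colors prescribed on the internal triples of an implication gadget and off its internal
vertices are realized by a single map. -/
theorem Implication.exists_glued_coloring {V : Type*} {k : ℕ} {G : SimpleGraph V}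
    {L : V → Finset (Fin k)} {u1 u2 : V} {c1 c2 : Fin k} {w : Fin k → V × V × V}
    (h : Implication G L u1 u2 c1 c2 w) (c₀ : V → Fin k) (t : Fin k → Fin k × Fin k × Fin k) :
    ∃ c : V → Fin k, (∀ v, v ∉ ImplicationInternals c2 w → c v = c₀ v) ∧
      ∀ c', c' ≠ c2 → c (w c').1 = (t c').1 ∧ c (w c').2.1 = (t c').2.1 ∧
        c (w c').2.2 = (t c').2.2 := by
  classical
  have key : ∀ v, ∃ a : Fin k, (v ∉ ImplicationInternals c2 w → a = c₀ v) ∧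
      ∀ c', c' ≠ c2 → (v = (w c').1 → a = (t c').1) ∧ (v = (w c').2.1 → a = (t c').2.1) ∧
        (v = (w c').2.2 → a = (t c').2.2) := by
    intro v
    by_cases hv : v ∈ ImplicationInternals c2 w
    · obtain ⟨d, hd, hvd⟩ := hv
      refine ⟨if v = (w d).1 then (t d).1 else if v = (w d).2.1 then (t d).2.1 else (t d).2.2,
        fun hn => absurd ⟨d, hd, hvd⟩ hn, fun c' hc' => ?_⟩
      by_cases hdc : d = c'
      · subst hdc
        have hnodup := (h.1 d hd).1.1
        simp only [List.nodup_cons, List.mem_cons, not_or] at hnodup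
        grind
      · have hdisj := Set.disjoint_left.mp (h.2 d c' hd hc' hdc) (show v ∈ _ by simpa using hvd)
        simp only [Set.mem_insert_iff, Set.mem_singleton_iff, not_or] at hdisj
        exact ⟨fun e => absurd e hdisj.1, fun e => absurd e hdisj.2.1,
          fun e => absurd e hdisj.2.2⟩
    · exact ⟨c₀ v, fun _ => rfl, fun c' hc' => ⟨fun e => absurd ⟨c', hc', .inl e⟩ hv,
        fun e => absurd ⟨c', hc', .inr (.inl e)⟩ hv,
        fun e => absurd ⟨c', hc', .inr (.inr e)⟩ hv⟩⟩
  choose c hoff hon using key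
  exact ⟨c, hoff, fun c' hc' => ⟨(hon _ c' hc').1 rfl, (hon _ c' hc').2.1 rfl,
    (hon _ c' hc').2.2 rfl⟩⟩

/-- The ends of an implication gadget are not internal vertices. -/
theorem Implication.ends_notMem_internals {V : Type*} {k : ℕ} {G : SimpleGraph V}
    {L : V → Finset (Fin k)} {u1 u2 : V} {c1 c2 : Fin k} {w : Fin k → V × V × V}
    (h : Implication G L u1 u2 c1 c2 w) :
    u1 ∉ ImplicationInternals c2 w ∧ u2 ∉ ImplicationInternals c2 w := by
  constructor <;>
  · rintro ⟨c', hc', hv⟩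
    have hnodup := (h.1 c' hc').1.1
    simp only [List.nodup_cons, List.mem_cons, not_or] at hnodup
    grind

/-- A map that is proper along the path of a weak edge is proper on every edge of the graph
at an internal vertex of that path. -/
theorem WeakEdgePath.ne_of_adj {V α : Type*} {G : SimpleGraph V} {u1 u2 v1 v2 v3 : V}
    (h : WeakEdgePath G u1 u2 v1 v2 v3) {c : V → α} (h1 : c u1 ≠ c v1) (h2 : c v1 ≠ c v2)
    (h3 : c v2 ≠ c v3) (h4 : c v3 ≠ c u2) {x y : V} (hx : x = v1 ∨ x = v2 ∨ x = v3)
    (hxy : G.Adj x y) : c x ≠ c y := by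
  obtain ⟨-, -, -, -, -, n1, n2, -, n3, n4, n5, hout⟩ := h
  have hy : y = u1 ∨ y = v1 ∨ y = v2 ∨ y = v3 ∨ y = u2 := by
    by_contra hy
    have := hout y (by simpa using hy)
    rcases hx with rfl | rfl | rfl <;> tauto
  have := hxy.symm
  have := hxy.ne
  rcases hx with rfl | rfl | rfl <;> rcases hy with rfl | rfl | rfl | rfl | rfl <;> grind

/-- if `G` contains a `(c1 → c2)`-implication gadget from `u1` to `u2`,
then any proper list coloring of `G` minus the internal vertices of the gadget that
either does not assign `c1` to `u1` or assigns `c2` to `u2` extends to a proper list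
coloring of `G`.  A coloring of the induced subgraph `G'` on the complement of the
internal vertices is modelled as a map `c₀ : V → Fin k` whose list and properness
conditions are only required outside the internal vertices; the extension agrees
with `c₀` there. -/
theorem implication_extends {k : ℕ} (hk : 3 ≤ k) {V : Type*} (G : SimpleGraph V)
    (L : V → Finset (Fin k)) (u1 u2 : V) (c1 c2 : Fin k) (w : Fin k → V × V × V)
    (himp : Implication G L u1 u2 c1 c2 w)
    (c₀ : V → Fin k)
    (hc₀L : ∀ v, v ∉ ImplicationInternals c2 w → c₀ v ∈ L v)
    (hc₀adj : ∀ x y, x ∉ ImplicationInternals c2 w → y ∉ ImplicationInternals c2 w →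
      G.Adj x y → c₀ x ≠ c₀ y)
    (hfree : c₀ u1 ≠ c1 ∨ c₀ u2 = c2) :
    ∃ c : V → Fin k, ProperListColoring G L c ∧
      ∀ v, v ∉ ImplicationInternals c2 w → c v = c₀ v := by
  have hcol : ∀ c', ∃ t : Fin k × Fin k × Fin k, c' ≠ c2 →
      t.1 ∈ L (w c').1 ∧ t.2.1 ∈ L (w c').2.1 ∧ t.2.2 ∈ L (w c').2.2 ∧
      c₀ u1 ≠ t.1 ∧ t.1 ≠ t.2.1 ∧ t.2.1 ≠ t.2.2 ∧ t.2.2 ≠ c₀ u2 := by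
    intro c'
    by_cases hc' : c' = c2
    · exact ⟨(c1, c1, c1), fun hn => absurd hc' hn⟩
    · obtain ⟨t, ht⟩ := (himp.1 c' hc').exists_internal_colors (p := c₀ u1) (q := c₀ u2)
        (hfree.imp_right fun e : c₀ u2 = c2 => e ▸ Ne.symm hc')
      exact ⟨t, fun _ => ht⟩
  choose t ht using hcol
  obtain ⟨c, hoff, hon⟩ := himp.exists_glued_coloring c₀ t
  have hinternal : ∀ x y, x ∈ ImplicationInternals c2 w → G.Adj x y → c x ≠ c y := by
    rintro x y ⟨c', hc', hx⟩ hxy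
    obtain ⟨e1, e2, e3⟩ := hon c' hc'
    obtain ⟨-, -, -, h1, h2, h3, h4⟩ := ht c' hc'
    rw [← hoff u1 himp.ends_notMem_internals.1, ← e1] at h1
    rw [← e1, ← e2] at h2
    rw [← e2, ← e3] at h3
    rw [← hoff u2 himp.ends_notMem_internals.2, ← e3] at h4
    exact (himp.1 c' hc').1.ne_of_adj h1 h2 h3 h4 hx hxy
  refine ⟨c, ⟨fun v => ?_, fun x y hxy => ?_⟩, hoff⟩
  · by_cases hv : v ∈ ImplicationInternals c2 w
    · obtain ⟨c', hc', hv⟩ := hv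
      obtain ⟨e1, e2, e3⟩ := hon c' hc'
      obtain ⟨h1, h2, h3, -⟩ := ht c' hc'
      rcases hv with rfl | rfl | rfl
      · rwa [e1]
      · rwa [e2]
      · rwa [e3]
    · rw [hoff v hv]
      exact hc₀L v hv
  · by_cases hx : x ∈ ImplicationInternals c2 w
    · exact hinternal x y hx hxy
    by_cases hy : y ∈ ImplicationInternals c2 w
    · exact (hinternal y x hy hxy.symm).symm
    rw [hoff x hx, hoff y hy]
    exact hc₀adj x y hx hy hxy
end

section
/- Let k ≥ 3 be an integer, G a simple graph with vertex set V, lists L : V → Finset (Fin k), and S = {s_1, …, s_n} ⊆ V an independent set with n ≥ 1 and L(s_i) = {1, 2, 3} for all i. Suppose G contains an OR(S) gadget, i.e., n+1 internal vertices t_0, …, t_n whose only neighbors in G are given by the path t_0, s_1, t_1, s_2, t_2, …, s_n, t_n, with lists L(t_0) = {2}, L(t_n) = {3}, and L(t_i) = {2, 3} for 0 < i < n. Then every proper list coloring of G assigns color 1 to at least one vertex of S. -/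
/-- if `G` contains an OR gadget on the independent set
`S = {s 0, …, s (n-1)}` (whose lists are `{o1, o2, o3}`), with internal path vertices
`t 0, …, t n` whose only neighbors are along the path
`t 0, s 0, t 1, s 1, …, s (n-1), t n`, and lists `L (t 0) = {o2}`,
`L (t n) = {o3}` and `{o2, o3}` in between, then every proper list coloring of `G`
assigns color `o1` to some vertex of `S`. -/
theorem or_gadget_forces {k : ℕ} (hk : 3 ≤ k) {V : Type*} (G : SimpleGraph V)
    (L : V → Finset (Fin k))
    -- the three fixed distinct colors playing the role of 1, 2, 3
    (o1 o2 o3 : Fin k) (h12 : o1 ≠ o2) (h13 : o1 ≠ o3) (h23 : o2 ≠ o3)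
    (n : ℕ) (hn : 1 ≤ n) (s : Fin n → V) (t : Fin (n + 1) → V)
    (hs : Function.Injective s) (ht : Function.Injective t)
    (hst : ∀ i j, s i ≠ t j)
    -- `S` is an independent set
    (hind : ∀ i j, ¬ G.Adj (s i) (s j))
    -- lists
    (hLs : ∀ i, L (s i) = {o1, o2, o3})
    (hLt0 : L (t 0) = {o2}) (hLtn : L (t (Fin.last n)) = {o3})
    (hLt : ∀ i : Fin (n + 1), i ≠ 0 → i ≠ Fin.last n → L (t i) = {o2, o3})
    -- the path edges of the gadget
    (hadj1 : ∀ q : Fin n, G.Adj (t q.castSucc) (s q))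
    (hadj2 : ∀ q : Fin n, G.Adj (s q) (t q.succ))
    -- the internal vertices have no other neighbors
    (honly : ∀ (i : Fin (n + 1)) (x : V), G.Adj (t i) x →
      ∃ q : Fin n, x = s q ∧ (i = q.castSucc ∨ i = q.succ)) :
    ∀ c : V → Fin k, (∀ v, c v ∈ L v) → (∀ ⦃x y : V⦄, G.Adj x y → c x ≠ c y) →
      ∃ i : Fin n, c (s i) = o1 := by
  intro c hcL hc
  by_contra! hne
  have all_o2 : ∀ i : Fin (n + 1), c (t i) = o2 := by
    intro i
    induction i using Fin.induction with
    | zero => simpa [hLt0] using hcL (t 0)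
    | succ q ih =>
      have hsq : c (s q) = o3 := by
        have hmem := hcL (s q)
        have hsep := hc (hadj1 q)
        rw [ih] at hsep
        simpa [hLs, hne q, hsep.symm] using hmem
      have hsep := hc (hadj2 q)
      rw [hsq] at hsep
      have hmem := hcL (t q.succ)
      by_cases hlast : q.succ = Fin.last n
      · rw [hlast] at hsep hmem
        rw [hLtn, Finset.mem_singleton] at hmem
        exact absurd hmem.symm hsep
      · rw [hLt _ (Fin.succ_ne_zero q) hlast] at hmem
        simpa [hsep.symm] using hmem
  have hmem := hcL (t (Fin.last n))
  rw [hLtn, Finset.mem_singleton, all_o2] at hmem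
  exact h23 hmem
end

section
/- Let k ≥ 3 be an integer and consider the graph H induced by an OR(S) gadget on an independent set S = {s_1, …, s_n} (n ≥ 1) with lists L(s_i) = {1, 2, 3}, together with its internal vertices t_0, …, t_n: H is the path t_0, s_1, t_1, s_2, t_2, …, s_n, t_n with lists L(t_0) = {2}, L(t_n) = {3}, L(t_i) = {2, 3} for 0 < i < n. Then for every i ∈ {1, …, n} there exists a proper list coloring of H that assigns color 1 to s_i and assigns color 1 to no other vertex of H. -/
/-- The graph of the OR gadget itself: the path `t 0, s 0, t 1, s 1, …, s (n-1), t n`,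
with `S`-vertices `Sum.inl j` and internal vertices `Sum.inr q`. -/
def orGadgetGraph (n : ℕ) : SimpleGraph (Fin n ⊕ Fin (n + 1)) :=
  SimpleGraph.fromRel fun x y =>
    ∃ (j : Fin n) (q : Fin (n + 1)),
      x = Sum.inl j ∧ y = Sum.inr q ∧ (q = j.castSucc ∨ q = j.succ)

/-- The lists of the OR gadget: `{o1, o2, o3}` on the `S`-vertices, `{o2}` on `t 0`,
`{o3}` on `t n` and `{o2, o3}` on the internal vertices in between. -/
def orGadgetLists {k : ℕ} (n : ℕ) (o1 o2 o3 : Fin k) :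
    Fin n ⊕ Fin (n + 1) → Finset (Fin k) :=
  Sum.elim (fun _ => ({o1, o2, o3} : Finset (Fin k)))
    (fun q => if q = 0 then {o2} else if q = Fin.last n then {o3} else {o2, o3})

/-- in the graph induced by an OR gadget on `S = {s_1, …, s_n}` (`n ≥ 1`),
for every `i` there is a proper list coloring assigning color `o1` (the color playing
the role of `1`) to `s_i` and to no other vertex. -/
theorem or_gadget_selects {k : ℕ} (hk : 3 ≤ k)
    (o1 o2 o3 : Fin k) (h12 : o1 ≠ o2) (h13 : o1 ≠ o3) (h23 : o2 ≠ o3)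
    (n : ℕ) (hn : 1 ≤ n) :
    ∀ i : Fin n, ∃ c : Fin n ⊕ Fin (n + 1) → Fin k,
      (∀ v, c v ∈ orGadgetLists n o1 o2 o3 v) ∧
      (∀ ⦃x y⦄, (orGadgetGraph n).Adj x y → c x ≠ c y) ∧
      c (Sum.inl i) = o1 ∧ ∀ x, x ≠ Sum.inl i → c x ≠ o1 := by
  intro i
  refine ⟨Sum.elim (fun j => if j = i then o1 else if j < i then o3 else o2)
    (fun q => if q ≤ i.castSucc then o2 else o3), ?_, ?_, by simp, ?_⟩
  · rintro (j | q)
    · simp only [orGadgetLists, Sum.elim_inl]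
      split_ifs <;> simp
    · simp only [orGadgetLists, Sum.elim_inr, Fin.le_def, Fin.ext_iff, Fin.val_castSucc,
        Fin.val_last, Fin.val_zero]
      have hi := i.isLt
      split_ifs <;> first | omega | simp
  · have key : ∀ (j : Fin n) (q : Fin (n + 1)), (q = j.castSucc ∨ q = j.succ) →
        (if j = i then o1 else if j < i then o3 else o2) ≠
          if q ≤ i.castSucc then o2 else o3 := by
      intro j q hq
      simp only [Fin.le_def, Fin.lt_def, Fin.ext_iff, Fin.val_castSucc, Fin.val_succ] at hq ⊢
      split_ifs <;> omega
    intro x y hxy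
    obtain ⟨-, ⟨j, q, rfl, rfl, hq⟩ | ⟨j, q, rfl, rfl, hq⟩⟩ := hxy
    · exact key j q hq
    · exact (key j q hq).symm
  · rintro (j | q) hx
    · have hj : j ≠ i := fun h => hx (congrArg Sum.inl h)
      simp only [Sum.elim_inl, if_neg hj]
      split_ifs
      exacts [h13.symm, h12.symm]
    · simp only [Sum.elim_inr]
      split_ifs
      exacts [h12.symm, h13.symm]
end

section
/- Let G be a simple graph on a finite vertex set V and k an integer. Suppose V is partitioned into nonempty classes C_1, …, C_t such that each C_i induces a clique in G and any two vertices in the same class have the same closed neighborhood (vertices in the same class are true twins). Then G admits a proper k-coloring if and only if there exist sets S_1, …, S_t ⊆ Fin k such that |S_i| = |C_i| for every i, and S_i ∩ S_j = ∅ whenever i ≠ j and some vertex of C_i is adjacent in G to some vertex of C_j. -/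
/-- if `V` is partitioned into nonempty classes `C 1, …, C t` of true
twins, each inducing a clique, then `G` is `k`-colorable iff there are color sets
`S i ⊆ Fin k` with `|S i| = |C i|` that are disjoint on classes joined by an edge. -/
theorem colorable_iff_multicoloring {V : Type*} [Fintype V] (G : SimpleGraph V)
    (k t : ℕ) (C : Fin t → Finset V)
    (hne : ∀ i, (C i).Nonempty)
    (hdisj : ∀ i j, i ≠ j → Disjoint (C i) (C j))
    (hcover : ∀ x : V, ∃ i, x ∈ C i)
    (hclique : ∀ i, ∀ x ∈ C i, ∀ y ∈ C i, x ≠ y → G.Adj x y)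
    (htwin : ∀ i, ∀ x ∈ C i, ∀ y ∈ C i,
      insert x (G.neighborSet x) = insert y (G.neighborSet y)) :
    G.Colorable k ↔ ∃ S : Fin t → Finset (Fin k),
      (∀ i, (S i).card = (C i).card) ∧
      ∀ i j, i ≠ j → (∃ x ∈ C i, ∃ y ∈ C j, G.Adj x y) → Disjoint (S i) (S j) := by
  classical
  have adj_of_mem : ∀ i j, i ≠ j → ∀ x ∈ C i, ∀ y ∈ C j, G.Adj x y →
      ∀ z ∈ C i, G.Adj z y := by
    intro i j hij x hx y hy hxy z hz
    have hy' : y ∈ insert z (G.neighborSet z) := by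
      rw [← htwin i x hx z hz]
      exact Set.mem_insert_of_mem _ hxy
    rcases hy' with rfl | h
    · exact absurd hy (Finset.disjoint_left.mp (hdisj i j hij) hz)
    · exact h
  constructor
  · rintro ⟨c⟩
    refine ⟨fun i => (C i).image c, fun i => Finset.card_image_of_injOn ?_, ?_⟩
    · intro x hx y hy hxy
      by_contra hne'
      exact c.valid (hclique i x hx y hy hne') hxy
    · rintro i j hij ⟨x, hx, y, hy, hxy⟩
      rw [Finset.disjoint_left]
      intro a ha hb
      obtain ⟨x', hx', rfl⟩ := Finset.mem_image.mp ha
      obtain ⟨y', hy', hc⟩ := Finset.mem_image.mp hb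
      have hx'y := adj_of_mem i j hij x hx y hy hxy x' hx'
      exact c.valid (adj_of_mem j i hij.symm y hy x' hx' hx'y.symm y' hy') hc
  · rintro ⟨S, hcard, hS⟩
    choose cls hcls using hcover
    let e : ∀ i, C i ≃ S i := fun i => Finset.equivOfCardEq (hcard i).symm
    have e_ne : ∀ i, ∀ x y (hx : x ∈ C i) (hy : y ∈ C i), x ≠ y →
        (e i ⟨x, hx⟩ : Fin k) ≠ e i ⟨y, hy⟩ := by
      intro i x y hx hy hxy h
      exact hxy (congrArg Subtype.val ((e i).injective (Subtype.ext h)))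
    refine ⟨SimpleGraph.Coloring.mk (fun x => (e (cls x) ⟨x, hcls x⟩ : Fin k)) ?_⟩
    intro x y hxy
    have hx := hcls x
    have hy := hcls y
    change (e (cls x) ⟨x, hx⟩ : Fin k) ≠ e (cls y) ⟨y, hy⟩
    generalize cls x = i at hx ⊢
    generalize cls y = j at hy ⊢
    by_cases hij : i = j
    · subst hij
      exact e_ne i x y hx hy hxy.ne
    · intro h
      refine Finset.disjoint_left.mp (hS i j hij ⟨x, hx, y, hy, hxy⟩) (e i ⟨x, hx⟩).2 ?_
      rw [h]
      exact (e j ⟨y, hy⟩).2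
end

section
/- (Lemma mpw1.) Fix k ≥ 3, set B = C(k, ⌊k/2⌋), and let T be a bijection from {1, …, B} to the family of ⌊k/2⌋-element subsets of Fin k. Let φ be a CSP instance over domain {1, …, B} with variables x_1, …, x_n and constraints c_0, …, c_{m−1}, where each constraint c_j has variable set var(c_j) and a nonempty set S_j of satisfying assignments var(c_j) → {1, …, B}. Form the list-coloring instance G(φ) over colors Fin k as follows. Vertices and lists: for each i, a clique V_i of ⌊k/2⌋ vertices with full lists {1, …, k}; for each j, an OR(S_j) gadget whose non-internal vertices are indexed by the assignments a ∈ S_j and have lists {1,2,3}, together with its |S_j|+1 internal path vertices with lists as in the OR gadget definition; for each j, each a ∈ S_j, and each variable x_i ∈ var(c_j), a set U_i^{j,a} of ⌈k/2⌉ vertices with full lists, and for each color c ∈ Fin k \ T(a(x_i)) the internal vertices of a (1→c)-implication gadget from the vertex of S_j representing a to a distinct vertex of U_i^{j,a}. Edges: the clique edges inside each V_i; the OR-gadget path edges; the weak-edge path edges inside each implication gadget (whose internal vertices have no other neighbors); and all edges between every vertex of U_i^{j,a} and every vertex of V_i. Then: if φ has a satisfying assignment, G(φ) admits a proper list coloring.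 -/
namespace Mpw

/- Throughout, the number of colors is `k = K + 3 ≥ 3`, and the paper's colors
`1, 2, 3` are `0, 1, 2 : Fin (K + 3)`. -/

variable (K n m B : ℕ)
variable (T : Fin B ≃ {s : Finset (Fin (K + 3)) // s.card = (K + 3) / 2})
variable (S : Fin m → Finset (Fin n → Fin B)) (vr : Fin m → Finset (Fin n))

/-- First color different from `c` (used in the `c1 = c2` weak-edge lists). -/
def aux1 (c : Fin (K + 3)) : Fin (K + 3) := if c = 0 then 1 else 0

/-- Second color different from `c` and from `aux1 c`. -/
def aux2 (c : Fin (K + 3)) : Fin (K + 3) := if c = 0 ∨ c = 1 then 2 else 1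

/-- A color outside `{c1, c2}` (used in the `c1 ≠ c2` weak-edge lists). -/
def auxc (c1 c2 : Fin (K + 3)) : Fin (K + 3) :=
  if c1 ≠ 0 ∧ c2 ≠ 0 then 0 else if c1 ≠ 1 ∧ c2 ≠ 1 then 1 else 2

/-- The lists of the three internal vertices of a `(c1,c2)`-weak edge. -/
def wlist (c1 c2 : Fin (K + 3)) : Fin 3 → Finset (Fin (K + 3)) :=
  if c1 = c2 then ![{c1, aux1 K c1}, {aux1 K c1, aux2 K c1}, {c1, aux2 K c1}]
  else ![{c1, c2}, {c2, auxc K c1 c2}, {c2, auxc K c1 c2}]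

/-- The `r`-th color of `Fin (K+3) \ T (a i)`: the color of the `r`-th vertex of
`U_i^{j,a}` forced by the implication gadgets when the vertex of the OR gadget
representing the assignment `a` receives color `1` (here `0`). -/
def target (a : Fin n → Fin B) (i : Fin n) (r : Fin ((K + 3) - (K + 3) / 2)) :
    Fin (K + 3) :=
  ((((T (a i) : Finset (Fin (K + 3)))ᶜ).orderIsoOfFin
      (by simp [Finset.card_compl, (T (a i)).2])) r : Fin (K + 3))

/-- The vertices of `G(φ)`: the cliques `V_i`; the OR-gadget vertices `s` indexed by the
satisfying assignments `a ∈ S j`; the internal OR-path vertices `t`; the sets `U_i^{j,a}`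
(of size `⌈k/2⌉ = k - ⌊k/2⌋`); and, for each vertex `U_i^{j,a}(r)` and each color
`c' ≠ target`, the three internal vertices of the `(1,c')`-weak edge of the
`(1 → target)`-implication gadget. -/
def MVert : Type :=
  (Fin n × Fin ((K + 3) / 2)) ⊕
  (Σ j : Fin m, {a : Fin n → Fin B // a ∈ S j}) ⊕
  (Σ j : Fin m, Fin ((S j).card + 1)) ⊕
  (Σ j : Fin m, Σ a : {a : Fin n → Fin B // a ∈ S j},
    {i : Fin n // i ∈ vr j} × Fin ((K + 3) - (K + 3) / 2)) ⊕
  (Σ j : Fin m, Σ a : {a : Fin n → Fin B // a ∈ S j}, Σ i : {i : Fin n // i ∈ vr j},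
    Σ r : Fin ((K + 3) - (K + 3) / 2),
      {c' : Fin (K + 3) // c' ≠ target K n B T a.1 i.1 r} × Fin 3)

/-- vertex of the clique `V_i`. -/
def vx (i : Fin n) (p : Fin ((K + 3) / 2)) : MVert K n m B T S vr := Sum.inl (i, p)

/-- OR-gadget vertex representing the satisfying assignment `a ∈ S j`. -/
def sx (j : Fin m) (a : {a : Fin n → Fin B // a ∈ S j}) : MVert K n m B T S vr :=
  Sum.inr (Sum.inl ⟨j, a⟩)

/-- internal vertex of the OR gadget of constraint `j`. -/
def tx (j : Fin m) (q : Fin ((S j).card + 1)) : MVert K n m B T S vr :=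
  Sum.inr (Sum.inr (Sum.inl ⟨j, q⟩))

/-- the `r`-th vertex of `U_i^{j,a}`. -/
def ux (j : Fin m) (a : {a : Fin n → Fin B // a ∈ S j}) (i : {i : Fin n // i ∈ vr j})
    (r : Fin ((K + 3) - (K + 3) / 2)) : MVert K n m B T S vr :=
  Sum.inr (Sum.inr (Sum.inr (Sum.inl ⟨j, a, i, r⟩)))

/-- the `p`-th internal vertex of the `(1,c')`-weak edge from `sx j a` to `ux j a i r`. -/
def wx (j : Fin m) (a : {a : Fin n → Fin B // a ∈ S j}) (i : {i : Fin n // i ∈ vr j})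
    (r : Fin ((K + 3) - (K + 3) / 2))
    (c' : {c' : Fin (K + 3) // c' ≠ target K n B T a.1 i.1 r}) (p : Fin 3) :
    MVert K n m B T S vr :=
  Sum.inr (Sum.inr (Sum.inr (Sum.inr ⟨j, a, i, r, c', p⟩)))

/-- The edges of `G(φ)` (to be symmetrized by `SimpleGraph.fromRel`): the clique edges
inside each `V_i`; the OR-gadget path edges (with the vertices of `S j` enumerated by
`(S j).equivFin.symm`); the weak-edge path edges of the implication gadgets; and all
edges between `U_i^{j,a}` and `V_i`. -/
def rel (x y : MVert K n m B T S vr) : Prop :=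
  (∃ (i : Fin n) (p p' : Fin ((K + 3) / 2)), p ≠ p' ∧
    x = vx K n m B T S vr i p ∧ y = vx K n m B T S vr i p') ∨
  (∃ (j : Fin m) (q : Fin (S j).card),
    x = tx K n m B T S vr j q.castSucc ∧ y = sx K n m B T S vr j ((S j).equivFin.symm q)) ∨
  (∃ (j : Fin m) (q : Fin (S j).card),
    x = sx K n m B T S vr j ((S j).equivFin.symm q) ∧ y = tx K n m B T S vr j q.succ) ∨
  (∃ (j : Fin m) (a : {a : Fin n → Fin B // a ∈ S j}) (i : {i : Fin n // i ∈ vr j})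
      (r : Fin ((K + 3) - (K + 3) / 2))
      (c' : {c' : Fin (K + 3) // c' ≠ target K n B T a.1 i.1 r}),
    x = sx K n m B T S vr j a ∧ y = wx K n m B T S vr j a i r c' 0) ∨
  (∃ (j : Fin m) (a : {a : Fin n → Fin B // a ∈ S j}) (i : {i : Fin n // i ∈ vr j})
      (r : Fin ((K + 3) - (K + 3) / 2))
      (c' : {c' : Fin (K + 3) // c' ≠ target K n B T a.1 i.1 r}),
    x = wx K n m B T S vr j a i r c' 0 ∧ y = wx K n m B T S vr j a i r c' 1) ∨
  (∃ (j : Fin m) (a : {a : Fin n → Fin B // a ∈ S j}) (i : {i : Fin n // i ∈ vr j})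
      (r : Fin ((K + 3) - (K + 3) / 2))
      (c' : {c' : Fin (K + 3) // c' ≠ target K n B T a.1 i.1 r}),
    x = wx K n m B T S vr j a i r c' 1 ∧ y = wx K n m B T S vr j a i r c' 2) ∨
  (∃ (j : Fin m) (a : {a : Fin n → Fin B // a ∈ S j}) (i : {i : Fin n // i ∈ vr j})
      (r : Fin ((K + 3) - (K + 3) / 2))
      (c' : {c' : Fin (K + 3) // c' ≠ target K n B T a.1 i.1 r}),
    x = wx K n m B T S vr j a i r c' 2 ∧ y = ux K n m B T S vr j a i r) ∨
  (∃ (j : Fin m) (a : {a : Fin n → Fin B // a ∈ S j}) (i : {i : Fin n // i ∈ vr j})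
      (r : Fin ((K + 3) - (K + 3) / 2)) (p : Fin ((K + 3) / 2)),
    x = ux K n m B T S vr j a i r ∧ y = vx K n m B T S vr i.1 p)

/-- The graph `G(φ)`. -/
def graph : SimpleGraph (MVert K n m B T S vr) :=
  SimpleGraph.fromRel (rel K n m B T S vr)

/-- The lists of `G(φ)`: full lists on the cliques `V_i` and the sets `U_i^{j,a}`,
`{1,2,3}` (here `{0,1,2}`) on the OR-gadget vertices `S j`, the OR-gadget internal lists
on the path vertices, and the weak-edge lists on the implication-gadget internals. -/
def lists : MVert K n m B T S vr → Finset (Fin (K + 3)) :=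
  Sum.elim (fun _ => Finset.univ) <|
  Sum.elim (fun _ => ({0, 1, 2} : Finset (Fin (K + 3)))) <|
  Sum.elim (fun z => if z.2 = 0 then {1}
    else if z.2 = Fin.last (S z.1).card then {2} else {1, 2}) <|
  Sum.elim (fun _ => Finset.univ) <|
  fun z => wlist K 0 z.2.2.2.2.1.1 z.2.2.2.2.2

/-- `σ` satisfies the CSP instance: for every constraint `j`, the restriction of `σ`
to `vr j` agrees with some satisfying assignment `a ∈ S j`. -/
def Satisfies (σ : Fin n → Fin B) : Prop :=
  ∀ j : Fin m, ∃ a ∈ S j, ∀ i ∈ vr j, σ i = a i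

theorem zero_ne_two_fin : (0 : Fin (K + 3)) ≠ 2 := by
  rw [Ne, Fin.ext_iff, Fin.val_two]
  simp

theorem one_ne_two_fin : (1 : Fin (K + 3)) ≠ 2 := by
  rw [Ne, Fin.ext_iff, Fin.val_two]
  simp

/-- A `(1,c')`-weak edge extends any coloring of its ends, except `1` and `c'`. -/
theorem exists_weak_edge_extension (c' s u : Fin (K + 3)) (h : ¬(s = 0 ∧ u = c')) :
    ∃ w : Fin 3 → Fin (K + 3), (∀ p, w p ∈ wlist K 0 c' p) ∧
      s ≠ w 0 ∧ w 0 ≠ w 1 ∧ w 1 ≠ w 2 ∧ w 2 ≠ u := by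
  have h01 := zero_ne_one (α := Fin (K + 3))
  have h02 := zero_ne_two_fin K
  have h12 := one_ne_two_fin K
  by_cases hc : c' = 0
  · subst hc
    have hl : wlist K 0 0 = ![{0, 1}, {1, 2}, {0, 2}] := by
      simp [wlist, aux1, aux2]
    rw [hl]
    by_cases hs : s = 0
    · refine ⟨![1, 2, 0], ?_, ?_⟩
      · simp [Fin.forall_fin_succ]
      · simp; grind
    · by_cases hu : u = 0
      · refine ⟨![0, 1, 2], ?_, ?_⟩
        · simp [Fin.forall_fin_succ]
        · simp; grind
      · refine ⟨![0, 1, 0], ?_, ?_⟩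
        · simp [Fin.forall_fin_succ]
        · simp; grind
  · obtain ⟨x, hl, hx0, hxc⟩ : ∃ x, wlist K 0 c' = ![{0, c'}, {c', x}, {c', x}] ∧
        x ≠ 0 ∧ x ≠ c' := by
      refine ⟨auxc K 0 c', by simp [wlist, Ne.symm hc], ?_, ?_⟩ <;>
        · unfold auxc; grind
    rw [hl]
    by_cases hs : s = 0
    · refine ⟨![c', x, c'], ?_, ?_⟩
      · simp [Fin.forall_fin_succ]
      · simp; grind
    · by_cases hu : u = c'
      · refine ⟨![0, c', x], ?_, ?_⟩
        · simp [Fin.forall_fin_succ]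
        · simp; grind
      · refine ⟨![0, x, c'], ?_, ?_⟩
        · simp [Fin.forall_fin_succ]
        · simp; grind

/-- The color of the `q`-th vertex of an OR gadget whose vertex `q₀` receives color `1`. -/
def orColor {N : ℕ} (q₀ q : Fin N) : Fin (K + 3) :=
  if q < q₀ then 2 else if q = q₀ then 0 else 1

/-- The color of the `q`-th internal vertex of an OR gadget whose vertex `q₀` receives
color `1`. -/
def orPathColor {N : ℕ} (q₀ : Fin N) (q : Fin (N + 1)) : Fin (K + 3) :=
  if q ≤ q₀.castSucc then 1 else 2

/-- The `p`-th color of `T (a i)`. -/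
def cliqueColor (a : Fin n → Fin B) (i : Fin n) (p : Fin ((K + 3) / 2)) : Fin (K + 3) :=
  (T (a i) : Finset (Fin (K + 3))).orderIsoOfFin (T (a i)).2 p

theorem cliqueColor_mem (a : Fin n → Fin B) (i : Fin n) (p : Fin ((K + 3) / 2)) :
    cliqueColor K n B T a i p ∈ (T (a i) : Finset (Fin (K + 3))) :=
  Subtype.prop _

theorem cliqueColor_injective (a : Fin n → Fin B) (i : Fin n) :
    Function.Injective (cliqueColor K n B T a i) :=
  Subtype.val_injective.comp (OrderIso.injective _)

theorem target_notMem (a : Fin n → Fin B) (i : Fin n)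
    (r : Fin ((K + 3) - (K + 3) / 2)) :
    target K n B T a i r ∉ (T (a i) : Finset (Fin (K + 3))) := by
  rw [← Finset.mem_compl]
  exact Subtype.prop _

theorem target_congr {a b : Fin n → Fin B} {i : Fin n} (h : a i = b i)
    (r : Fin ((K + 3) - (K + 3) / 2)) :
    target K n B T a i r = target K n B T b i r := by
  simp only [target, Finset.coe_orderIsoOfFin_apply, h]

theorem orColor_mem {N : ℕ} (q₀ q : Fin N) :
    orColor K q₀ q ∈ ({0, 1, 2} : Finset (Fin (K + 3))) := by
  unfold orColor
  split_ifs <;> simp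

theorem orPathColor_mem {N : ℕ} (q₀ : Fin N) (q : Fin (N + 1)) :
    orPathColor K q₀ q ∈
      (if q = 0 then {1} else if q = Fin.last N then {2} else {1, 2} :
        Finset (Fin (K + 3))) := by
  have h0 : q = 0 → q ≤ q₀.castSucc := by rintro rfl; exact Fin.zero_le _
  have hl : q = Fin.last N → ¬q ≤ q₀.castSucc := by
    rintro rfl
    exact (Fin.castSucc_lt_last q₀).not_ge
  unfold orPathColor
  grind

theorem orPathColor_castSucc_ne {N : ℕ} (q₀ q : Fin N) :
    orPathColor K q₀ q.castSucc ≠ orColor K q₀ q := by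
  have h01 := zero_ne_one (α := Fin (K + 3))
  have h12 := one_ne_two_fin K
  simp only [orPathColor, orColor, Fin.castSucc_le_castSucc_iff]
  grind

theorem orColor_ne_orPathColor_succ {N : ℕ} (q₀ q : Fin N) :
    orColor K q₀ q ≠ orPathColor K q₀ q.succ := by
  have h02 := zero_ne_two_fin K
  have h12 := one_ne_two_fin K
  simp only [orPathColor, orColor, Fin.succ_le_castSucc_iff]
  grind

theorem eq_of_orColor_eq_zero {N : ℕ} {q₀ q : Fin N} (h : orColor K q₀ q = 0) : q = q₀ := by
  have h01 := zero_ne_one (α := Fin (K + 3))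
  have h02 := zero_ne_two_fin K
  unfold orColor at h
  grind

/-- Lemma mpw1: with `k = K + 3`, `B = C(k, ⌊k/2⌋)`, `T` a bijection
between `{1, …, B}` and the `⌊k/2⌋`-subsets of the color set, and `φ` a CSP instance
with nonempty sets of satisfying assignments: if `φ` is satisfiable, then `G(φ)`
admits a proper list coloring. -/
theorem mpw1 (hB : B = Nat.choose (K + 3) ((K + 3) / 2))
    (hS : ∀ j, (S j).Nonempty)
    (hsat : ∃ σ : Fin n → Fin B, Satisfies n m B S vr σ) :
    ∃ c : MVert K n m B T S vr → Fin (K + 3),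
      (∀ v, c v ∈ lists K n m B T S vr v) ∧
      ∀ ⦃x y⦄, (graph K n m B T S vr).Adj x y → c x ≠ c y := by
 
  obtain ⟨σ, hσ⟩ := hsat
  choose a ha hσa using hσ
  let q₀ (j : Fin m) : Fin (S j).card := (S j).equivFin ⟨a j, ha j⟩
  have hw (j : Fin m) (b : {a : Fin n → Fin B // a ∈ S j}) (i : {i : Fin n // i ∈ vr j})
      (r : Fin ((K + 3) - (K + 3) / 2))
      (c' : {c' : Fin (K + 3) // c' ≠ target K n B T b.1 i.1 r}) :=
    exists_weak_edge_extension K c'.1 (orColor K (q₀ j) ((S j).equivFin b))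
      (target K n B T σ i.1 r) (by
        rintro ⟨h0, hu⟩
        obtain rfl : b = ⟨a j, ha j⟩ :=
          (S j).equivFin.injective (eq_of_orColor_eq_zero K h0)
        exact c'.2 (hu ▸ target_congr K n B T (hσa j i.1 i.2) r))
  choose w hwl hw0 hw1 hw2 hw3 using hw
  let c : MVert K n m B T S vr → Fin (K + 3) :=
    Sum.elim (fun z => cliqueColor K n B T σ z.1 z.2) <|
    Sum.elim (fun z => orColor K (q₀ z.1) ((S z.1).equivFin z.2)) <|
    Sum.elim (fun z => orPathColor K (q₀ z.1) z.2) <|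
    Sum.elim (fun z => target K n B T σ z.2.2.1.1 z.2.2.2) <|
    fun z => w z.1 z.2.1 z.2.2.1 z.2.2.2.1 z.2.2.2.2.1 z.2.2.2.2.2
  have hrel (x y) (h : rel K n m B T S vr x y) : c x ≠ c y := by
    rcases h with ⟨i, p, p', hp, rfl, rfl⟩ | ⟨j, q, rfl, rfl⟩ | ⟨j, q, rfl, rfl⟩ |
      ⟨j, b, i, r, c', rfl, rfl⟩ | ⟨j, b, i, r, c', rfl, rfl⟩ | ⟨j, b, i, r, c', rfl, rfl⟩ |
      ⟨j, b, i, r, c', rfl, rfl⟩ | ⟨j, b, i, r, p, rfl, rfl⟩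
    · exact (cliqueColor_injective K n B T σ i).ne hp
    · simpa [c, tx, sx] using orPathColor_castSucc_ne K (q₀ j) q
    · simpa [c, tx, sx] using orColor_ne_orPathColor_succ K (q₀ j) q
    · exact hw0 j b i r c'
    · exact hw1 j b i r c'
    · exact hw2 j b i r c'
    · exact hw3 j b i r c'
    · exact (ne_of_mem_of_not_mem (cliqueColor_mem K n B T σ i.1 p)
        (target_notMem K n B T σ i.1 r)).symm
  refine ⟨c, ?_, fun x y h => ?_⟩
  · rintro (z | z | ⟨j, q⟩ | z | ⟨j, b, i, r, c', p⟩)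
    · exact Finset.mem_univ _
    · exact orColor_mem K (q₀ z.1) ((S z.1).equivFin z.2)
    · exact orPathColor_mem K (q₀ j) q
    · exact Finset.mem_univ _
    · exact hwl j b i r c' p
  · rcases h.2 with h | h
    · exact hrel x y h
    · exact (hrel y x h).symm

end Mpw
end

section
/- (Lemma cw1.) Fix k ≥ 3, set B = 2^k − 2, and let T be a bijection from {1, …, B} to the family of nonempty proper subsets of Fin k. Let φ be a CSP instance over domain {1, …, B} with variables x_1, …, x_n and constraints c_0, …, c_{m−1}, each constraint c_j having a nonempty set of satisfying assignments, and set L = 3m(nk + 1). Form the list-coloring instance G(φ) over colors Fin k as follows. For each index j ∈ {0, …, L − 1}, with j' = j mod m and S the set of satisfying assignments of c_{j'}: an OR(S_j) gadget whose non-internal vertices S_j are indexed by the assignments a ∈ S and have lists {1,2,3}, with its internal path vertices as in the OR gadget definition; and for each variable x_i ∈ var(c_{j'}) and each a ∈ S, writing v = a(x_i): an independent set V_i^{j,a} of |T(v)| vertices and an independent set U_i^{j,a} of k − |T(v)| vertices, both with full lists {1, …, k}; for each color c ∈ T(v) a (1→c)-implication gadget from the vertex of S_j representing a to a distinct vertex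 of V_i^{j,a}; for each color c ∈ Fin k \ T(v) a (1→c)-implication gadget from the vertex of S_j representing a to a distinct vertex of U_i^{j,a}; and all edges between every vertex of U_i^{j,a} and every vertex of every set V_i^{l,a'} with l < j (over all assignments a' for which V_i^{l,a'} exists). The internal vertices of all gadgets have no neighbors outside their own gadget paths. Then: if φ has a satisfying assignment, G(φ) admits a proper list coloring. -/
namespace Cw

/- Throughout, the number of colors is `k = K + 3 ≥ 3`, and the paper's colors
`1, 2, 3` are `0, 1, 2 : Fin (K + 3)`. -/

variable (K n m B : ℕ)
variable (T : Fin B ≃ {s : Finset (Fin (K + 3)) // s.Nonempty ∧ s ≠ Finset.univ})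
variable (S : Fin m → Finset (Fin n → Fin B)) (vr : Fin m → Finset (Fin n))

/-- The number `L = 3m(nk + 1)` of repetitions of the constraints. -/
def Lnum : ℕ := 3 * m * (n * (K + 3) + 1)

/-- `j' = j mod m`. -/
def jm (j : Fin (Lnum K n m)) : Fin m :=
  ⟨j.1 % m, Nat.mod_lt _ (Nat.pos_of_ne_zero fun hm => by
    have hpos : 0 < Lnum K n m := (Nat.zero_le _).trans_lt j.2
    simp [hm, Lnum] at hpos)⟩

/-- First color different from `c` (used in the `c1 = c2` weak-edge lists). -/
def aux1 (c : Fin (K + 3)) : Fin (K + 3) := if c = 0 then 1 else 0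

/-- Second color different from `c` and from `aux1 c`. -/
def aux2 (c : Fin (K + 3)) : Fin (K + 3) := if c = 0 ∨ c = 1 then 2 else 1

/-- A color outside `{c1, c2}` (used in the `c1 ≠ c2` weak-edge lists). -/
def auxc (c1 c2 : Fin (K + 3)) : Fin (K + 3) :=
  if c1 ≠ 0 ∧ c2 ≠ 0 then 0 else if c1 ≠ 1 ∧ c2 ≠ 1 then 1 else 2

/-- The lists of the three internal vertices of a `(c1,c2)`-weak edge. -/
def wlist (c1 c2 : Fin (K + 3)) : Fin 3 → Finset (Fin (K + 3)) :=
  if c1 = c2 then ![{c1, aux1 K c1}, {aux1 K c1, aux2 K c1}, {c1, aux2 K c1}]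
  else ![{c1, c2}, {c2, auxc K c1 c2}, {c2, auxc K c1 c2}]

/-- The `r`-th color of `T (a i)`: the color of the `r`-th vertex of `V_i^{j,a}` forced
by the implication gadgets when the OR-gadget vertex representing `a` gets color `1`. -/
def targetV (a : Fin n → Fin B) (i : Fin n)
    (r : Fin (T (a i) : Finset (Fin (K + 3))).card) : Fin (K + 3) :=
  (((T (a i) : Finset (Fin (K + 3))).orderIsoOfFin rfl) r : Fin (K + 3))

/-- The `r`-th color of `Fin (K+3) \ T (a i)`: the color of the `r`-th vertex of
`U_i^{j,a}` forced by the implication gadgets. -/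
def targetU (a : Fin n → Fin B) (i : Fin n)
    (r : Fin ((K + 3) - (T (a i) : Finset (Fin (K + 3))).card)) : Fin (K + 3) :=
  ((((T (a i) : Finset (Fin (K + 3)))ᶜ).orderIsoOfFin
      (by simp [Finset.card_compl])) r : Fin (K + 3))

/-- The vertices of `G(φ)`: for each `j < L` (with constraint `jm j = j mod m`),
the OR-gadget vertices indexed by the satisfying assignments `a ∈ S (jm j)`; the
internal OR-path vertices; the independent sets `V_i^{j,a}` of size `|T (a i)|` and
`U_i^{j,a}` of size `k - |T (a i)|`; and the internal vertices of the weak edges of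
the `(1 → c)`-implication gadgets towards `V_i^{j,a}` and `U_i^{j,a}`. -/
def CVert : Type :=
  (Σ j : Fin (Lnum K n m), {a : Fin n → Fin B // a ∈ S (jm K n m j)}) ⊕
  (Σ j : Fin (Lnum K n m), Fin ((S (jm K n m j)).card + 1)) ⊕
  (Σ j : Fin (Lnum K n m), Σ a : {a : Fin n → Fin B // a ∈ S (jm K n m j)},
    Σ i : {i : Fin n // i ∈ vr (jm K n m j)},
      Fin (T (a.1 i.1) : Finset (Fin (K + 3))).card) ⊕
  (Σ j : Fin (Lnum K n m), Σ a : {a : Fin n → Fin B // a ∈ S (jm K n m j)},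
    Σ i : {i : Fin n // i ∈ vr (jm K n m j)},
      Fin ((K + 3) - (T (a.1 i.1) : Finset (Fin (K + 3))).card)) ⊕
  (Σ j : Fin (Lnum K n m), Σ a : {a : Fin n → Fin B // a ∈ S (jm K n m j)},
    Σ i : {i : Fin n // i ∈ vr (jm K n m j)},
      Σ r : Fin (T (a.1 i.1) : Finset (Fin (K + 3))).card,
        {c' : Fin (K + 3) // c' ≠ targetV K n B T a.1 i.1 r} × Fin 3) ⊕
  (Σ j : Fin (Lnum K n m), Σ a : {a : Fin n → Fin B // a ∈ S (jm K n m j)},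
    Σ i : {i : Fin n // i ∈ vr (jm K n m j)},
      Σ r : Fin ((K + 3) - (T (a.1 i.1) : Finset (Fin (K + 3))).card),
        {c' : Fin (K + 3) // c' ≠ targetU K n B T a.1 i.1 r} × Fin 3)

/-- OR-gadget vertex representing the satisfying assignment `a ∈ S (jm j)`. -/
def sx (j : Fin (Lnum K n m)) (a : {a : Fin n → Fin B // a ∈ S (jm K n m j)}) :
    CVert K n m B T S vr :=
  Sum.inl ⟨j, a⟩

/-- internal vertex of the OR gadget at index `j`. -/
def tx (j : Fin (Lnum K n m)) (q : Fin ((S (jm K n m j)).card + 1)) :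
    CVert K n m B T S vr :=
  Sum.inr (Sum.inl ⟨j, q⟩)

/-- the `r`-th vertex of `V_i^{j,a}`. -/
def vx (j : Fin (Lnum K n m)) (a : {a : Fin n → Fin B // a ∈ S (jm K n m j)})
    (i : {i : Fin n // i ∈ vr (jm K n m j)})
    (r : Fin (T (a.1 i.1) : Finset (Fin (K + 3))).card) : CVert K n m B T S vr :=
  Sum.inr (Sum.inr (Sum.inl ⟨j, a, i, r⟩))

/-- the `r`-th vertex of `U_i^{j,a}`. -/
def ux (j : Fin (Lnum K n m)) (a : {a : Fin n → Fin B // a ∈ S (jm K n m j)})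
    (i : {i : Fin n // i ∈ vr (jm K n m j)})
    (r : Fin ((K + 3) - (T (a.1 i.1) : Finset (Fin (K + 3))).card)) :
    CVert K n m B T S vr :=
  Sum.inr (Sum.inr (Sum.inr (Sum.inl ⟨j, a, i, r⟩)))

/-- the `p`-th internal vertex of the `(1,c')`-weak edge from `sx j a` to `vx j a i r`. -/
def wvx (j : Fin (Lnum K n m)) (a : {a : Fin n → Fin B // a ∈ S (jm K n m j)})
    (i : {i : Fin n // i ∈ vr (jm K n m j)})
    (r : Fin (T (a.1 i.1) : Finset (Fin (K + 3))).card)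
    (c' : {c' : Fin (K + 3) // c' ≠ targetV K n B T a.1 i.1 r}) (p : Fin 3) :
    CVert K n m B T S vr :=
  Sum.inr (Sum.inr (Sum.inr (Sum.inr (Sum.inl ⟨j, a, i, r, c', p⟩))))

/-- the `p`-th internal vertex of the `(1,c')`-weak edge from `sx j a` to `ux j a i r`. -/
def wux (j : Fin (Lnum K n m)) (a : {a : Fin n → Fin B // a ∈ S (jm K n m j)})
    (i : {i : Fin n // i ∈ vr (jm K n m j)})
    (r : Fin ((K + 3) - (T (a.1 i.1) : Finset (Fin (K + 3))).card))
    (c' : {c' : Fin (K + 3) // c' ≠ targetU K n B T a.1 i.1 r}) (p : Fin 3) :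
    CVert K n m B T S vr :=
  Sum.inr (Sum.inr (Sum.inr (Sum.inr (Sum.inr ⟨j, a, i, r, c', p⟩))))

/-- The edges of `G(φ)` (to be symmetrized by `SimpleGraph.fromRel`): the OR-gadget
path edges (with the vertices of `S (jm j)` enumerated by `(S (jm j)).equivFin.symm`);
the weak-edge path edges of the implication gadgets towards `V_i^{j,a}` and towards
`U_i^{j,a}`; and all edges between `U_i^{j,a}` and every `V_i^{l,a'}` with `l < j`
(same variable `i`). -/
def rel (x y : CVert K n m B T S vr) : Prop :=
  (∃ (j : Fin (Lnum K n m)) (q : Fin (S (jm K n m j)).card),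
    x = tx K n m B T S vr j q.castSucc ∧
    y = sx K n m B T S vr j ((S (jm K n m j)).equivFin.symm q)) ∨
  (∃ (j : Fin (Lnum K n m)) (q : Fin (S (jm K n m j)).card),
    x = sx K n m B T S vr j ((S (jm K n m j)).equivFin.symm q) ∧
    y = tx K n m B T S vr j q.succ) ∨
  -- implication gadgets towards `V_i^{j,a}`
  (∃ (j : Fin (Lnum K n m)) (a : {a : Fin n → Fin B // a ∈ S (jm K n m j)})
      (i : {i : Fin n // i ∈ vr (jm K n m j)})
      (r : Fin (T (a.1 i.1) : Finset (Fin (K + 3))).card)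
      (c' : {c' : Fin (K + 3) // c' ≠ targetV K n B T a.1 i.1 r}),
    x = sx K n m B T S vr j a ∧ y = wvx K n m B T S vr j a i r c' 0) ∨
  (∃ (j : Fin (Lnum K n m)) (a : {a : Fin n → Fin B // a ∈ S (jm K n m j)})
      (i : {i : Fin n // i ∈ vr (jm K n m j)})
      (r : Fin (T (a.1 i.1) : Finset (Fin (K + 3))).card)
      (c' : {c' : Fin (K + 3) // c' ≠ targetV K n B T a.1 i.1 r}),
    x = wvx K n m B T S vr j a i r c' 0 ∧ y = wvx K n m B T S vr j a i r c' 1) ∨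
  (∃ (j : Fin (Lnum K n m)) (a : {a : Fin n → Fin B // a ∈ S (jm K n m j)})
      (i : {i : Fin n // i ∈ vr (jm K n m j)})
      (r : Fin (T (a.1 i.1) : Finset (Fin (K + 3))).card)
      (c' : {c' : Fin (K + 3) // c' ≠ targetV K n B T a.1 i.1 r}),
    x = wvx K n m B T S vr j a i r c' 1 ∧ y = wvx K n m B T S vr j a i r c' 2) ∨
  (∃ (j : Fin (Lnum K n m)) (a : {a : Fin n → Fin B // a ∈ S (jm K n m j)})
      (i : {i : Fin n // i ∈ vr (jm K n m j)})
      (r : Fin (T (a.1 i.1) : Finset (Fin (K + 3))).card)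
      (c' : {c' : Fin (K + 3) // c' ≠ targetV K n B T a.1 i.1 r}),
    x = wvx K n m B T S vr j a i r c' 2 ∧ y = vx K n m B T S vr j a i r) ∨
  -- implication gadgets towards `U_i^{j,a}`
  (∃ (j : Fin (Lnum K n m)) (a : {a : Fin n → Fin B // a ∈ S (jm K n m j)})
      (i : {i : Fin n // i ∈ vr (jm K n m j)})
      (r : Fin ((K + 3) - (T (a.1 i.1) : Finset (Fin (K + 3))).card))
      (c' : {c' : Fin (K + 3) // c' ≠ targetU K n B T a.1 i.1 r}),
    x = sx K n m B T S vr j a ∧ y = wux K n m B T S vr j a i r c' 0) ∨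
  (∃ (j : Fin (Lnum K n m)) (a : {a : Fin n → Fin B // a ∈ S (jm K n m j)})
      (i : {i : Fin n // i ∈ vr (jm K n m j)})
      (r : Fin ((K + 3) - (T (a.1 i.1) : Finset (Fin (K + 3))).card))
      (c' : {c' : Fin (K + 3) // c' ≠ targetU K n B T a.1 i.1 r}),
    x = wux K n m B T S vr j a i r c' 0 ∧ y = wux K n m B T S vr j a i r c' 1) ∨
  (∃ (j : Fin (Lnum K n m)) (a : {a : Fin n → Fin B // a ∈ S (jm K n m j)})
      (i : {i : Fin n // i ∈ vr (jm K n m j)})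
      (r : Fin ((K + 3) - (T (a.1 i.1) : Finset (Fin (K + 3))).card))
      (c' : {c' : Fin (K + 3) // c' ≠ targetU K n B T a.1 i.1 r}),
    x = wux K n m B T S vr j a i r c' 1 ∧ y = wux K n m B T S vr j a i r c' 2) ∨
  (∃ (j : Fin (Lnum K n m)) (a : {a : Fin n → Fin B // a ∈ S (jm K n m j)})
      (i : {i : Fin n // i ∈ vr (jm K n m j)})
      (r : Fin ((K + 3) - (T (a.1 i.1) : Finset (Fin (K + 3))).card))
      (c' : {c' : Fin (K + 3) // c' ≠ targetU K n B T a.1 i.1 r}),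
    x = wux K n m B T S vr j a i r c' 2 ∧ y = ux K n m B T S vr j a i r) ∨
  -- the join between `U_i^{j,a}` and the earlier `V_i^{l,a'}`
  (∃ (j l : Fin (Lnum K n m)) (a : {a : Fin n → Fin B // a ∈ S (jm K n m j)})
      (a' : {a' : Fin n → Fin B // a' ∈ S (jm K n m l)})
      (i : {i : Fin n // i ∈ vr (jm K n m j)})
      (i' : {i' : Fin n // i' ∈ vr (jm K n m l)})
      (r : Fin ((K + 3) - (T (a.1 i.1) : Finset (Fin (K + 3))).card))
      (r' : Fin (T (a'.1 i'.1) : Finset (Fin (K + 3))).card),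
    l.1 < j.1 ∧ i'.1 = i.1 ∧
    x = ux K n m B T S vr j a i r ∧ y = vx K n m B T S vr l a' i' r')

/-- The graph `G(φ)`. -/
def graph : SimpleGraph (CVert K n m B T S vr) :=
  SimpleGraph.fromRel (rel K n m B T S vr)

/-- The lists of `G(φ)`: `{1,2,3}` (here `{0,1,2}`) on the OR-gadget vertices, the
OR-gadget internal lists on the path vertices, full lists on the sets `V_i^{j,a}` and
`U_i^{j,a}`, and the weak-edge lists on the implication-gadget internals. -/
def lists : CVert K n m B T S vr → Finset (Fin (K + 3)) :=
  Sum.elim (fun _ => ({0, 1, 2} : Finset (Fin (K + 3)))) <|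
  Sum.elim (fun z => if z.2 = 0 then {1}
    else if z.2 = Fin.last (S (jm K n m z.1)).card then {2} else {1, 2}) <|
  Sum.elim (fun _ => Finset.univ) <|
  Sum.elim (fun _ => Finset.univ) <|
  Sum.elim (fun z => wlist K 0 z.2.2.2.2.1.1 z.2.2.2.2.2) <|
  fun z => wlist K 0 z.2.2.2.2.1.1 z.2.2.2.2.2

/-- `σ` satisfies the CSP instance: for every constraint `j`, the restriction of `σ`
to `vr j` agrees with some satisfying assignment `a ∈ S j`. -/
def Satisfies (σ : Fin n → Fin B) : Prop :=
  ∀ j : Fin m, ∃ a ∈ S j, ∀ i ∈ vr j, σ i = a i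

theorem distinct_colors : (0 : Fin (K + 3)) ≠ 1 ∧ (0 : Fin (K + 3)) ≠ 2 ∧ (1 : Fin (K + 3)) ≠ 2 := by
  have h : 2 % (K + 3) = 2 := Nat.mod_eq_of_lt (by omega)
  refine ⟨?_, ?_, ?_⟩ <;> simp [Fin.ext_iff, h]

/-- A `(0, c')`-weak edge whose end vertices are colored `x` and `y` can be colored
unless `x = 0` and `y = c'`. -/
theorem exists_weak_edge_coloring (c' x y : Fin (K + 3)) (h : x = 0 → y ≠ c') :
    ∃ f : Fin 3 → Fin (K + 3), (∀ p, f p ∈ wlist K 0 c' p) ∧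
      x ≠ f 0 ∧ f 0 ≠ f 1 ∧ f 1 ≠ f 2 ∧ f 2 ≠ y := by
  obtain ⟨h01, h02, h12⟩ := distinct_colors K
  by_cases hc : c' = 0
  · subst hc
    by_cases hx : x = 0
    · refine ⟨![1, 2, 0], ?_⟩
      simp [wlist, aux1, aux2, Fin.forall_fin_succ]
      grind
    · by_cases hy : y = 0
      · refine ⟨![0, 1, 2], ?_⟩
        simp [wlist, aux1, aux2, Fin.forall_fin_succ]
        grind
      · refine ⟨![0, 1, 0], ?_⟩
        simp [wlist, aux1, aux2, Fin.forall_fin_succ]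
        grind
  · have haux : auxc K 0 c' ≠ 0 ∧ auxc K 0 c' ≠ c' := by
      unfold auxc
      grind
    obtain ⟨h0, h'⟩ := haux
    by_cases hx : x = 0
    · refine ⟨![c', auxc K 0 c', c'], ?_⟩
      simp [wlist, Fin.forall_fin_succ, Ne.symm hc]
      grind
    · by_cases hy : y = c'
      · refine ⟨![0, c', auxc K 0 c'], ?_⟩
        simp [wlist, Fin.forall_fin_succ, Ne.symm hc]
        grind
      · refine ⟨![0, auxc K 0 c', c'], ?_⟩
        simp [wlist, Fin.forall_fin_succ, Ne.symm hc]
        grind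

theorem targetV_mem (a : Fin n → Fin B) (i : Fin n)
    (r : Fin (T (a i) : Finset (Fin (K + 3))).card) :
    targetV K n B T a i r ∈ (T (a i) : Finset (Fin (K + 3))) :=
  (((T (a i) : Finset (Fin (K + 3))).orderIsoOfFin rfl) r).2

theorem targetU_notMem (a : Fin n → Fin B) (i : Fin n)
    (r : Fin ((K + 3) - (T (a i) : Finset (Fin (K + 3))).card)) :
    targetU K n B T a i r ∉ (T (a i) : Finset (Fin (K + 3))) :=
  Finset.mem_compl.1 ((((T (a i) : Finset (Fin (K + 3)))ᶜ).orderIsoOfFin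
      (by simp [Finset.card_compl])) r).2

/-- Lemma cw1: with `k = K + 3`, `B = 2^k - 2`, `T` a bijection between
`{1, …, B}` and the nonempty proper subsets of the color set, and `φ` a CSP instance
with nonempty sets of satisfying assignments: if `φ` is satisfiable, then `G(φ)`
admits a proper list coloring. -/
theorem cw1 (hB : B = 2 ^ (K + 3) - 2)
    (hS : ∀ j, (S j).Nonempty)
    (hsat : ∃ σ : Fin n → Fin B, Satisfies n m B S vr σ) :
    ∃ c : CVert K n m B T S vr → Fin (K + 3),
      (∀ v, c v ∈ lists K n m B T S vr v) ∧
      ∀ ⦃x y⦄, (graph K n m B T S vr).Adj x y → c x ≠ c y := by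
  classical
  obtain ⟨h01, h02, h12⟩ := distinct_colors K
  obtain ⟨σ, hσ⟩ := hsat
  choose α hαS hα using hσ
  choose cin hcin using fun i => (T (σ i)).2.1
  have hout : ∀ i, ∃ c, c ∉ (T (σ i) : Finset (Fin (K + 3))) := fun i => by
    have h := (T (σ i)).2.2
    simpa [Finset.eq_univ_iff_forall] using h
  choose cout hcout using hout
  -- `pos j` is the position of the chosen assignment on the OR path.
  let pos : ∀ j : Fin (Lnum K n m), Fin (S (jm K n m j)).card := fun j =>
    (S (jm K n m j)).equivFin ⟨α (jm K n m j), hαS _⟩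
  let cs : ∀ j : Fin (Lnum K n m), {a // a ∈ S (jm K n m j)} → Fin (K + 3) := fun j a =>
    if (S (jm K n m j)).equivFin a < pos j then 2
    else if pos j < (S (jm K n m j)).equivFin a then 1 else 0
  have hcs : ∀ j a, cs j a = 0 → a.1 = α (jm K n m j) := by
    intro j a h
    have : (S (jm K n m j)).equivFin a = pos j := by
      simp only [cs] at h
      split_ifs at h with h1 h2
      · exact absurd h.symm h02
      · exact absurd h.symm h01
      · exact le_antisymm (not_lt.1 h2) (not_lt.1 h1)
    rw [(S (jm K n m j)).equivFin.injective this]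
  let ct : ∀ j : Fin (Lnum K n m), Fin ((S (jm K n m j)).card + 1) → Fin (K + 3) :=
    fun j q => if q.1 ≤ (pos j).1 then 1 else 2
  let cV : ∀ (j : Fin (Lnum K n m)) (a : {a // a ∈ S (jm K n m j)})
      (i : {i // i ∈ vr (jm K n m j)}),
      Fin (T (a.1 i.1) : Finset (Fin (K + 3))).card → Fin (K + 3) := fun j a i r =>
    if a.1 = α (jm K n m j) then targetV K n B T a.1 i.1 r else cin i.1
  let cU : ∀ (j : Fin (Lnum K n m)) (a : {a // a ∈ S (jm K n m j)})
      (i : {i // i ∈ vr (jm K n m j)}),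
      Fin ((K + 3) - (T (a.1 i.1) : Finset (Fin (K + 3))).card) → Fin (K + 3) := fun j a i r =>
    if a.1 = α (jm K n m j) then targetU K n B T a.1 i.1 r else cout i.1
  have hcV : ∀ j a i r, cV j a i r ∈ (T (σ i.1) : Finset (Fin (K + 3))) := by
    intro j a i r
    simp only [cV]
    split_ifs with h
    · have h2 := targetV_mem K n B T a.1 i.1 r
      rwa [show a.1 i.1 = σ i.1 by rw [h, hα _ _ i.2]] at h2
    · exact hcin _
  have hcU : ∀ j a i r, cU j a i r ∉ (T (σ i.1) : Finset (Fin (K + 3))) := by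
    intro j a i r
    simp only [cU]
    split_ifs with h
    · have h2 := targetU_notMem K n B T a.1 i.1 r
      rwa [show a.1 i.1 = σ i.1 by rw [h, hα _ _ i.2]] at h2
    · exact hcout _
  have hV : ∀ j a i r (c' : {c' : Fin (K + 3) // c' ≠ targetV K n B T a.1 i.1 r}),
      cs j a = 0 → cV j a i r ≠ c' := by
    intro j a i r c' h
    simp only [cV, if_pos (hcs j a h)]
    exact c'.2.symm
  have hU : ∀ j a i r (c' : {c' : Fin (K + 3) // c' ≠ targetU K n B T a.1 i.1 r}),
      cs j a = 0 → cU j a i r ≠ c' := by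
    intro j a i r c' h
    simp only [cU, if_pos (hcs j a h)]
    exact c'.2.symm
  choose wV hwVl hwV0 hwV1 hwV2 hwV3 using fun j a i r c' =>
    exists_weak_edge_coloring K _ _ _ (hV j a i r c')
  choose wU hwUl hwU0 hwU1 hwU2 hwU3 using fun j a i r c' =>
    exists_weak_edge_coloring K _ _ _ (hU j a i r c')
  let c : CVert K n m B T S vr → Fin (K + 3) :=
    Sum.elim (fun z => cs z.1 z.2) <|
    Sum.elim (fun z => ct z.1 z.2) <|
    Sum.elim (fun z => cV z.1 z.2.1 z.2.2.1 z.2.2.2) <|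
    Sum.elim (fun z => cU z.1 z.2.1 z.2.2.1 z.2.2.2) <|
    Sum.elim (fun z => wV z.1 z.2.1 z.2.2.1 z.2.2.2.1 z.2.2.2.2.1 z.2.2.2.2.2)
      (fun z => wU z.1 z.2.1 z.2.2.1 z.2.2.2.1 z.2.2.2.2.1 z.2.2.2.2.2)
  have hrel : ∀ x y, rel K n m B T S vr x y → c x ≠ c y := by
    rintro x y (⟨j, q, rfl, rfl⟩ | ⟨j, q, rfl, rfl⟩ | ⟨j, a, i, r, c', rfl, rfl⟩ |
      ⟨j, a, i, r, c', rfl, rfl⟩ | ⟨j, a, i, r, c', rfl, rfl⟩ | ⟨j, a, i, r, c', rfl, rfl⟩ |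
      ⟨j, a, i, r, c', rfl, rfl⟩ | ⟨j, a, i, r, c', rfl, rfl⟩ | ⟨j, a, i, r, c', rfl, rfl⟩ |
      ⟨j, a, i, r, c', rfl, rfl⟩ | ⟨j, l, a, a', i, i', r, r', -, hi, rfl, rfl⟩)
    · change ct j q.castSucc ≠ cs j _
      simp only [ct, cs, Equiv.apply_symm_apply, Fin.lt_def, Fin.val_castSucc]
      grind
    · change cs j _ ≠ ct j q.succ
      simp only [ct, cs, Equiv.apply_symm_apply, Fin.lt_def, Fin.val_succ]
      grind
    · exact hwV0 j a i r c'
    · exact hwV1 j a i r c'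
    · exact hwV2 j a i r c'
    · exact hwV3 j a i r c'
    · exact hwU0 j a i r c'
    · exact hwU1 j a i r c'
    · exact hwU2 j a i r c'
    · exact hwU3 j a i r c'
    · change cU j a i r ≠ cV l a' i' r'
      intro h
      apply hcU j a i r
      rw [h, ← hi]
      exact hcV l a' i' r'
  refine ⟨c, ?_, fun x y h => ?_⟩
  · rintro (⟨j, a⟩ | ⟨j, q⟩ | z | z | ⟨j, a, i, r, c', p⟩ | ⟨j, a, i, r, c', p⟩)
    · change cs j a ∈ ({0, 1, 2} : Finset (Fin (K + 3)))
      simp only [cs]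
      split_ifs <;> simp
    · change ct j q ∈ (if q = 0 then {1}
        else if q = Fin.last (S (jm K n m j)).card then {2} else {1, 2} : Finset (Fin (K + 3)))
      have hpos := (pos j).2
      simp only [ct, Fin.ext_iff, Fin.val_last, Fin.val_zero]
      grind
    · exact Finset.mem_univ _
    · exact Finset.mem_univ _
    · exact hwVl j a i r c' p
    · exact hwUl j a i r c' p
  · rcases (SimpleGraph.fromRel_adj _ _ _).1 h with ⟨-, h | h⟩
    · exact hrel x y h
    · exact (hrel y x h).symm

end Cw
end

section
/- (Lemma cw2.) Fix k ≥ 3, set B = 2^k − 2, and let T be a bijection from {1, …, B} to the family of nonempty proper subsets of Fin k. Let φ be a CSP instance over domain {1, …, B} with variables x_1, …, x_n and constraints c_0, …, c_{m−1}, each constraint having a nonempty set of satisfying assignments, set L = 3m(nk + 1), and let G(φ) be the list-coloring instance built from φ as follows. For each index j ∈ {0, …, L − 1}, with j' = j mod m and S the set of satisfying assignments of c_{j'}: an OR(S_j) gadget whose non-internal vertices S_j are indexed by the assignments a ∈ S and have lists {1,2,3}, with its internal path vertices as in the OR gadget definition; and for each variable x_i ∈ var(c_{j'}) and each a ∈ S,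 writing v = a(x_i): an independent set V_i^{j,a} of |T(v)| vertices and an independent set U_i^{j,a} of k − |T(v)| vertices, both with full lists {1, …, k}; for each color c ∈ T(v) a (1→c)-implication gadget from the vertex of S_j representing a to a distinct vertex of V_i^{j,a}; for each color c ∈ Fin k \ T(v) a (1→c)-implication gadget from the vertex of S_j representing a to a distinct vertex of U_i^{j,a}; and all edges between every vertex of U_i^{j,a} and every vertex of every set V_i^{l,a'} with l < j (over all assignments a' for which V_i^{l,a'} exists). The internal vertices of all gadgets have no neighbors outside their own gadget paths. Then: if G(φ) admits a proper list coloring, φ has a satisfying assignment. -/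
namespace Cw

/- Throughout, the number of colors is `k = K + 3 ≥ 3`, and the paper's colors
`1, 2, 3` are `0, 1, 2 : Fin (K + 3)`. -/

variable (K n m B : ℕ)
variable (T : Fin B ≃ {s : Finset (Fin (K + 3)) // s.Nonempty ∧ s ≠ Finset.univ})
variable (S : Fin m → Finset (Fin n → Fin B)) (vr : Fin m → Finset (Fin n))

variable {K n m B T S vr}

/-- If the first end of a `(0, d)`-weak edge has color `0`, its second end does not have
color `d`. -/
theorem ne_of_weak_edge {d y x₁ x₂ x₃ : Fin (K + 3)}
    (h₁ : x₁ ∈ wlist K 0 d 0) (h₂ : x₂ ∈ wlist K 0 d 1) (h₃ : x₃ ∈ wlist K 0 d 2)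
    (h₀₁ : 0 ≠ x₁) (h₁₂ : x₁ ≠ x₂) (h₂₃ : x₂ ≠ x₃) (h₃y : x₃ ≠ y) : y ≠ d := by
  by_cases hd : 0 = d
  · subst hd
    simp [wlist] at h₁ h₂ h₃
    grind
  · simp [wlist, hd] at h₁ h₂ h₃
    grind

/-- In an OR gadget some non-internal vertex gets color `0`: if a path alternates between
internal vertices `t` and vertices `s`, the internal vertices have colors in `{1, 2}`, and
the first and last ones have colors `1` and `2`, then not all `s` have colors in `{1, 2}`. -/
theorem exists_eq_zero_of_or_gadget {N : ℕ} (t : Fin (N + 1) → Fin (K + 3))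
    (s : Fin N → Fin (K + 3)) (ht : ∀ q, t q ∈ ({1, 2} : Finset (Fin (K + 3))))
    (hs : ∀ q, s q ∈ ({0, 1, 2} : Finset (Fin (K + 3))))
    (h_first : t 0 = 1) (h_last : t (Fin.last N) ≠ 1)
    (hts : ∀ q : Fin N, t q.castSucc ≠ s q) (hst : ∀ q : Fin N, s q ≠ t q.succ) :
    ∃ q, s q = 0 := by
  by_contra! h
  refine h_last (Fin.induction (motive := fun q => t q = 1) h_first (fun q hq => ?_) _)
  have h1 := ht q.succ
  have h2 := hs q
  have h3 := h q
  have h4 := hts q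
  have h5 := hst q
  simp only [Finset.mem_insert, Finset.mem_singleton] at h1 h2
  grind

/-- A monotone sequence of subsets of a finite type is stationary at one of the first
`card + 1` steps. -/
theorem exists_eq_succ_of_monotone {α : Type*} [Fintype α] {f : ℕ → Finset α}
    (hf : Monotone f) : ∃ b ≤ Fintype.card α, f b = f (b + 1) := by
  by_contra! h
  have key : ∀ b ≤ Fintype.card α + 1, b ≤ (f b).card := by
    intro b
    induction b with
    | zero => simp
    | succ b ih =>
      intro hb
      have hlt := Finset.card_lt_card
        (lt_of_le_of_ne (hf b.le_succ) (h b (Nat.le_of_succ_le_succ hb)))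
      have := ih (by lia)
      lia
  have := key _ le_rfl
  have := (f (Fintype.card α + 1)).card_le_univ
  lia

theorem exists_targetV_eq (a : Fin n → Fin B) (i : Fin n) {d : Fin (K + 3)}
    (hd : d ∈ (T (a i) : Finset (Fin (K + 3)))) : ∃ r, targetV K n B T a i r = d :=
  ⟨((T (a i) : Finset (Fin (K + 3))).orderIsoOfFin rfl).symm ⟨d, hd⟩, by simp [targetV]⟩

theorem exists_targetU_eq (a : Fin n → Fin B) (i : Fin n) {d : Fin (K + 3)}
    (hd : d ∉ (T (a i) : Finset (Fin (K + 3)))) : ∃ r, targetU K n B T a i r = d :=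
  ⟨(((T (a i) : Finset (Fin (K + 3)))ᶜ).orderIsoOfFin (by simp [Finset.card_compl])).symm
    ⟨d, by simpa using hd⟩, by simp [targetU]⟩

variable (T S vr) in
/-- A proper list coloring of `G(φ)`. -/
def IsProper (c : CVert K n m B T S vr → Fin (K + 3)) : Prop :=
  (∀ v, c v ∈ lists K n m B T S vr v) ∧
    ∀ ⦃x y⦄, (graph K n m B T S vr).Adj x y → c x ≠ c y

namespace IsProper

variable {c : CVert K n m B T S vr → Fin (K + 3)}

theorem ne_of_rel (hc : IsProper T S vr c) {x y : CVert K n m B T S vr} (hxy : x ≠ y)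
    (h : rel K n m B T S vr x y) : c x ≠ c y :=
  hc.2 ⟨hxy, Or.inl h⟩

theorem exists_sx_eq_zero (hc : IsProper T S vr c) (j : Fin (Lnum K n m))
    (hS : (S (jm K n m j)).Nonempty) : ∃ a, c (sx K n m B T S vr j a) = 0 := by
  have hlist (q) : c (tx K n m B T S vr j q) ∈ if q = 0 then ({1} : Finset (Fin (K + 3)))
      else if q = Fin.last (S (jm K n m j)).card then {2} else {1, 2} :=
    hc.1 (tx K n m B T S vr j q)
  have hcard : Fin.last (S (jm K n m j)).card ≠ 0 := by
    simpa [Fin.ext_iff] using hS.ne_empty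
  obtain ⟨q, hq⟩ := exists_eq_zero_of_or_gadget (fun q => c (tx K n m B T S vr j q))
    (fun q => c (sx K n m B T S vr j ((S (jm K n m j)).equivFin.symm q)))
    (fun q => by
      have := hlist q
      split_ifs at this <;> simp_all)
    (fun q => hc.1 (sx K n m B T S vr j _))
    (by simpa using hlist 0)
    (by
      have := hlist (Fin.last _)
      rw [if_neg hcard, if_pos rfl, Finset.mem_singleton] at this
      rw [this]
      simp [Fin.ext_iff, Nat.mod_eq_of_lt])
    (fun q => hc.ne_of_rel (fun h => by cases h) (Or.inl ⟨j, q, rfl, rfl⟩))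
    (fun q => hc.ne_of_rel (fun h => by cases h) (Or.inr <| Or.inl ⟨j, q, rfl, rfl⟩))
  exact ⟨_, hq⟩

theorem vx_eq_targetV (hc : IsProper T S vr c) {j : Fin (Lnum K n m)}
    {a : {a : Fin n → Fin B // a ∈ S (jm K n m j)}} (ha : c (sx K n m B T S vr j a) = 0)
    (i : {i : Fin n // i ∈ vr (jm K n m j)})
    (r : Fin (T (a.1 i.1) : Finset (Fin (K + 3))).card) :
    c (vx K n m B T S vr j a i r) = targetV K n B T a.1 i.1 r := by
  by_contra hne
  let d : {c' : Fin (K + 3) // c' ≠ targetV K n B T a.1 i.1 r} := ⟨_, hne⟩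
  refine ne_of_weak_edge (hc.1 (wvx K n m B T S vr j a i r d 0))
    (hc.1 (wvx K n m B T S vr j a i r d 1)) (hc.1 (wvx K n m B T S vr j a i r d 2))
    (ha ▸ hc.ne_of_rel (fun h => by cases h) ?_) (hc.ne_of_rel (fun h => by cases h) ?_)
    (hc.ne_of_rel (fun h => by cases h) ?_)
    (hc.ne_of_rel (y := vx K n m B T S vr j a i r) (fun h => by cases h) ?_) rfl
  · exact Or.inr <| Or.inr <| Or.inl ⟨j, a, i, r, d, rfl, rfl⟩
  · exact Or.inr <| Or.inr <| Or.inr <| Or.inl ⟨j, a, i, r, d, rfl, rfl⟩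
  · exact Or.inr <| Or.inr <| Or.inr <| Or.inr <| Or.inl ⟨j, a, i, r, d, rfl, rfl⟩
  · exact Or.inr <| Or.inr <| Or.inr <| Or.inr <| Or.inr <| Or.inl
      ⟨j, a, i, r, d, rfl, rfl⟩

theorem ux_eq_targetU (hc : IsProper T S vr c) {j : Fin (Lnum K n m)}
    {a : {a : Fin n → Fin B // a ∈ S (jm K n m j)}} (ha : c (sx K n m B T S vr j a) = 0)
    (i : {i : Fin n // i ∈ vr (jm K n m j)})
    (r : Fin ((K + 3) - (T (a.1 i.1) : Finset (Fin (K + 3))).card)) :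
    c (ux K n m B T S vr j a i r) = targetU K n B T a.1 i.1 r := by
  by_contra hne
  let d : {c' : Fin (K + 3) // c' ≠ targetU K n B T a.1 i.1 r} := ⟨_, hne⟩
  refine ne_of_weak_edge (hc.1 (wux K n m B T S vr j a i r d 0))
    (hc.1 (wux K n m B T S vr j a i r d 1)) (hc.1 (wux K n m B T S vr j a i r d 2))
    (ha ▸ hc.ne_of_rel (fun h => by cases h) ?_) (hc.ne_of_rel (fun h => by cases h) ?_)
    (hc.ne_of_rel (fun h => by cases h) ?_)
    (hc.ne_of_rel (y := ux K n m B T S vr j a i r) (fun h => by cases h) ?_) rfl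
  · exact Or.inr <| Or.inr <| Or.inr <| Or.inr <| Or.inr <| Or.inr <| Or.inl
      ⟨j, a, i, r, d, rfl, rfl⟩
  · exact Or.inr <| Or.inr <| Or.inr <| Or.inr <| Or.inr <| Or.inr <| Or.inr <| Or.inl
      ⟨j, a, i, r, d, rfl, rfl⟩
  · exact Or.inr <| Or.inr <| Or.inr <| Or.inr <| Or.inr <| Or.inr <| Or.inr <| Or.inr <|
      Or.inl ⟨j, a, i, r, d, rfl, rfl⟩
  · exact Or.inr <| Or.inr <| Or.inr <| Or.inr <| Or.inr <| Or.inr <| Or.inr <| Or.inr <|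
      Or.inr <| Or.inl ⟨j, a, i, r, d, rfl, rfl⟩

/-- The sets of colors encoding the values of a variable in the chosen satisfying assignments
grow along the sequence of constraints. -/
theorem subset_of_lt (hc : IsProper T S vr c) {l j : Fin (Lnum K n m)} (hlj : l < j)
    {a' : {a : Fin n → Fin B // a ∈ S (jm K n m l)}} (ha' : c (sx K n m B T S vr l a') = 0)
    {a : {a : Fin n → Fin B // a ∈ S (jm K n m j)}} (ha : c (sx K n m B T S vr j a) = 0)
    {i : Fin n} (hl : i ∈ vr (jm K n m l)) (hj : i ∈ vr (jm K n m j)) :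
    (T (a'.1 i) : Finset (Fin (K + 3))) ⊆ T (a.1 i) := by
  intro d hd
  by_contra hd'
  obtain ⟨r', hr'⟩ := exists_targetV_eq a'.1 i hd
  obtain ⟨r, hr⟩ := exists_targetU_eq a.1 i hd'
  have hne : c (ux K n m B T S vr j a ⟨i, hj⟩ r) ≠ c (vx K n m B T S vr l a' ⟨i, hl⟩ r') := by
    refine hc.ne_of_rel (fun h => by cases h) ?_
    unfold rel
    iterate 10 apply Or.inr
    exact ⟨j, l, a, a', ⟨i, hj⟩, ⟨i, hl⟩, r, r', hlj, rfl, rfl, rfl⟩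
  rw [hc.ux_eq_targetU ha, hc.vx_eq_targetV ha'] at hne
  exact hne (hr.trans hr'.symm)

end IsProper

/-- If the chosen assignments `a j` encode growing sets of colors, then some block of `m`
consecutive indices is free of changes: the assignments chosen there agree pairwise on common
variables. -/
theorem exists_block_agree (a : Fin (Lnum K n m) → Fin n → Fin B)
    (ha : ∀ ⦃l j⦄, l < j → ∀ i ∈ vr (jm K n m l), i ∈ vr (jm K n m j) →
      (T (a l i) : Finset (Fin (K + 3))) ⊆ T (a j i)) :
    ∃ b ≤ n * (K + 3), ∀ l j : Fin (Lnum K n m),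
      b * m ≤ l → (l : ℕ) < (b + 1) * m → b * m ≤ j → (j : ℕ) < (b + 1) * m →
      ∀ i ∈ vr (jm K n m l), i ∈ vr (jm K n m j) → a l i = a j i := by
  classical
  let f : ℕ → Finset (Fin n × Fin (K + 3)) := fun b => {p | ∃ l : Fin (Lnum K n m),
    (l : ℕ) < b * m ∧ p.1 ∈ vr (jm K n m l) ∧
      p.2 ∈ (T (a l p.1) : Finset (Fin (K + 3)))}
  have hf : Monotone f := fun b b' hb p hp => by
    simp only [f, Finset.mem_filter, Finset.mem_univ, true_and] at hp ⊢
    obtain ⟨l, hl, h⟩ := hp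
    exact ⟨l, hl.trans_le (Nat.mul_le_mul_right m hb), h⟩
  obtain ⟨b, hb, hfb⟩ := exists_eq_succ_of_monotone hf
  have hmem (i d) (l : Fin (Lnum K n m)) (hl : b * m ≤ l) (hl' : (l : ℕ) < (b + 1) * m)
      (hi : i ∈ vr (jm K n m l)) :
      d ∈ (T (a l i) : Finset (Fin (K + 3))) ↔ (i, d) ∈ f b := by
    constructor
    · intro hd
      rw [hfb]
      simp only [f, Finset.mem_filter, Finset.mem_univ, true_and]
      exact ⟨l, hl', hi, hd⟩
    · intro hd
      simp only [f, Finset.mem_filter, Finset.mem_univ, true_and] at hd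
      obtain ⟨l', hl'', hi', hd⟩ := hd
      exact ha (Fin.lt_def.2 (hl''.trans_le hl)) i hi' hi hd
  refine ⟨b, by simpa using hb, fun l j hl hl' hj hj' i hil hij => ?_⟩
  apply T.injective
  ext d
  rw [hmem i d l hl hl' hil, hmem i d j hj hj' hij]

variable (K n m B T S vr)

/-- Lemma cw2: with `k = K + 3`, `B = 2^k - 2`, `T` a bijection between
`{1, …, B}` and the nonempty proper subsets of the color set, and `φ` a CSP instance
with nonempty sets of satisfying assignments: if `G(φ)` admits a proper list coloring,
then `φ` is satisfiable. -/
theorem cw2 (hB : B = 2 ^ (K + 3) - 2)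
    (hS : ∀ j, (S j).Nonempty)
    (hcol : ∃ c : CVert K n m B T S vr → Fin (K + 3),
      (∀ v, c v ∈ lists K n m B T S vr v) ∧
      ∀ ⦃x y⦄, (graph K n m B T S vr).Adj x y → c x ≠ c y) :
    ∃ σ : Fin n → Fin B, Satisfies n m B S vr σ := by
  obtain ⟨c, hc⟩ := hcol
  have hc : IsProper T S vr c := hc
  choose a ha using fun j => hc.exists_sx_eq_zero j (hS _)
  obtain ⟨b, hb, hagree⟩ := exists_block_agree (T := T) (vr := vr) (fun j => (a j).1)
    fun l j hlj i hl hj => hc.subset_of_lt hlj (ha l) (ha j) hl hj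
  have hlt (j : Fin m) : b * m + j < Lnum K n m := by
    have : (b + 1) * m ≤ (n * (K + 3) + 1) * m := Nat.mul_le_mul_right m (by lia)
    have := j.2
    unfold Lnum
    nlinarith
  let idx (j : Fin m) : Fin (Lnum K n m) := ⟨b * m + j, hlt j⟩
  have hidx (j) : jm K n m (idx j) = j := by
    ext
    simp [jm, idx, Nat.add_mod, Nat.mod_eq_of_lt]
  have hB0 : 0 < B := by
    have := Nat.one_le_two_pow (n := K)
    rw [hB, pow_add]
    lia
  have hex (i : Fin n) : ∃ v, ∀ j, i ∈ vr j → v = (a (idx j)).1 i := by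
    by_cases h : ∃ j, i ∈ vr j
    · obtain ⟨j₀, hj₀⟩ := h
      refine ⟨(a (idx j₀)).1 i, fun j hj => hagree _ _ ?_ ?_ ?_ ?_ i ?_ ?_⟩
      · simp [idx]
      · simp [idx, add_mul]
      · simp [idx]
      · simp [idx, add_mul]
      · rwa [hidx]
      · rwa [hidx]
    · exact ⟨⟨0, hB0⟩, fun j hj => absurd ⟨j, hj⟩ h⟩
  choose σ hσ using hex
  exact ⟨σ, fun j => ⟨(a (idx j)).1, Eq.subst (motive := fun j' => (a (idx j)).1 ∈ S j')
    (hidx j) (a (idx j)).2, fun i hi => hσ i j hi⟩⟩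

end Cw
end
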